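/- For every n > 1 and every integer k ≥ ⌊n/2⌋ + 3, the group of invertible elements of the matrix ring M_k(T_n), equipped with the topology induced by the operator norm on M_k(B(H_n)), is connected. -/

import Mathlib

noncomputable section

/-- `H n` is the Hilbert space `ℓ²(ℕ^n)`. -/
abbrev Hn (n : ℕ) : Type := lp (fun _ : (Fin n → ℕ) => ℂ) 2

/-- the standard basis vector `δ_z`. -/
def delta {n : ℕ} (z : Fin n → ℕ) : Hn n := lp.single 2 z 1

/-- `T` is the `i`-th coordinate shift: `T δ_z = δ_{z + e_i}`. -/
def IsShift {n : ℕ} (i : Fin n) (T : Hn n →L[ℂ] Hn n) : Prop :=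
  ∀ z : Fin n → ℕ, T (delta z) = delta (Function.update z i (z i + 1))

/-- The Toeplitz algebra `T_n`: the smallest norm-closed star-subalgebra of `B(H_n)`
containing the coordinate shifts. -/
def Toeplitz (n : ℕ) : StarSubalgebra ℂ (Hn n →L[ℂ] Hn n) :=
  (StarAlgebra.adjoin ℂ {T : Hn n →L[ℂ] Hn n | ∃ i : Fin n, IsShift i T}).topologicalClosure

section Pencil

open Matrix unitInterval

variable {R : Type*} [NormedRing R] [CompleteSpace R]

theorem joined_units_of_path {f : ℝ → R} (hf : Continuous f)
    (hu : ∀ r ∈ Set.Icc (0 : ℝ) 1, IsUnit (f r)) {u v : Rˣ} (h0 : (u : R) = f 0)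
    (h1 : (v : R) = f 1) : Joined u v := by
  let γ : I → Rˣ := fun t => (hu t t.2).unit
  have hγ : Continuous γ := by
    rw [Units.isOpenEmbedding_val.isEmbedding.continuous_iff]
    exact hf.comp continuous_subtype_val
  exact ⟨⟨⟨γ, hγ⟩, Units.ext (by simp [γ, h0]), Units.ext (by simp [γ, h1])⟩⟩

variable [NormedAlgebra ℝ R]

theorem isUnit_one_add_smul_of_pow_bounded {w : R} {M : ℝ} (hw : ∀ j : ℕ, ‖w ^ j‖ ≤ M)
    {r : ℝ} (h0 : 0 ≤ r) (h1 : r < 1) : IsUnit (1 + r • w) := by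
  have hM : 0 ≤ M := (norm_nonneg _).trans (hw 0)
  obtain ⟨K, hK⟩ : ∃ K : ℕ, r ^ K * M < 1 := by
    have := (tendsto_pow_atTop_nhds_zero_of_lt_one h0 h1).mul_const M
    rw [zero_mul] at this
    exact (this.eventually_lt_const one_pos).exists
  have hlt : ‖(-(r • w)) ^ K‖ < 1 := by
    refine lt_of_le_of_lt ?_ hK
    rw [← neg_smul, smul_pow, norm_smul, norm_pow, norm_neg, Real.norm_of_nonneg h0]
    exact mul_le_mul_of_nonneg_left (hw K) (by positivity)
  have hu := isUnit_one_sub_of_norm_lt_one hlt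
  rw [← mul_neg_geom_sum] at hu
  have hc : Commute (1 - -(r • w)) (∑ i ∈ Finset.range K, (-(r • w)) ^ i) :=
    (mul_neg_geom_sum _ K).trans (geom_sum_mul_neg _ K).symm
  simpa using (hc.isUnit_mul_iff.1 hu).1

/-- A block-tridiagonal invertible Toeplitz pencil `a s + b + s' c` is connected, through
invertible elements, to its Schur complement, which is the inverse of the corner `g`. -/
theorem joined_schur_of_pencil {s s' a b c g : R} (x : Rˣ) (hs : s' * s = 1)
    (ha : Commute a s) (ha' : Commute a s') (hb : Commute b s)
    (hc : Commute c s) (hc' : Commute c s') (hgs : Commute g s) (hgs' : Commute g s')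
    (hb' : Commute b s')
    (hx : (x : R) = a * s + b + s' * c)
    (hg : (1 - s * s') * ↑x⁻¹ * (1 - s * s') = g * (1 - s * s'))
    (𝒜 : Subring R) (haA : a ∈ 𝒜) (hbA : b ∈ 𝒜) (hcA : c ∈ 𝒜) (hgA : g ∈ 𝒜) {K : ℝ}
    (hK0 : 0 ≤ K) (hK : ∀ α ∈ 𝒜, ‖α‖ ≤ K * ‖α * (1 - s * s')‖) {K' : ℝ}
    (hsb : ∀ j : ℕ, ‖s ^ j‖ ≤ K')
    (hsb' : ∀ j : ℕ, ‖s' ^ j‖ ≤ K') :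
    ∃ h : Rˣ, (h : R) = b - c * g * a ∧ (↑h⁻¹ : R) = g ∧ Joined x h := by
  set e : R := 1 - s * s' with he
  set y : R := ↑x⁻¹ with hy
  have hxy : (x : R) * y = 1 := x.mul_inv
  have hyx : y * (x : R) = 1 := x.inv_mul
  have hes : e * s = 0 := by rw [he, sub_mul, mul_assoc, hs]; simp
  have hse : s' * e = 0 := by rw [he, mul_sub, ← mul_assoc, hs]; simp
  have hee : e * e = e := by
    conv_lhs => rw [he, sub_mul, one_mul, ← he, mul_assoc, hse, mul_zero, sub_zero]
  have comm_e : ∀ {z : R}, Commute z s → Commute z s' → Commute z e := fun h h' =>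
    (Commute.one_right _).sub_right (h.mul_right h')
  have hae := comm_e ha ha'
  have hbe := comm_e hb hb'
  have hce := comm_e hc hc'
  have hge := comm_e hgs hgs'
  have hxs : (x : R) * s' = s' * x - a * e := by
    have h1 : s' * (a * s) = a := by rw [← mul_assoc, ← ha'.eq, mul_assoc, hs, mul_one]
    rw [hx, mul_add, mul_add, h1, he, add_mul, add_mul, mul_sub, hb'.eq, mul_assoc s' c, hc'.eq]
    noncomm_ring
  have hsx : s * (x : R) = x * s - e * c := by
    have h1 : s' * c * s = c := by rw [mul_assoc, hc.eq, ← mul_assoc, hs, one_mul]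
    rw [hx, add_mul, add_mul, h1, he, mul_add, mul_add, sub_mul, ← mul_assoc s a, ← ha.eq, hb.eq]
    noncomm_ring
  have hcol : s' * (y * e) = -(y * e) * (a * g) := by
    have h2 : (x : R) * (s' * (y * e)) = -(a * g * e) := by
      rw [← mul_assoc, hxs, sub_mul, mul_assoc s', ← mul_assoc _ y, hxy, one_mul, hse,
        mul_assoc a e, ← mul_assoc e y, hg]
      noncomm_ring
    calc s' * (y * e) = y * (x * (s' * (y * e))) := by rw [← mul_assoc y, hyx, one_mul]
      _ = _ := by rw [h2, (hae.mul_left hge).eq]; noncomm_ring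
  have hrow : e * y * s = -(g * c) * (e * y) := by
    have h2 : e * y * s * x = -(g * c * e) := by
      rw [mul_assoc, hsx, mul_sub, ← mul_assoc, mul_assoc e y x, hyx, mul_one, hes,
        ← mul_assoc, hg, mul_assoc g e c, ← hce.eq]
      noncomm_ring
    calc e * y * s = e * y * s * x * y := by rw [mul_assoc _ (x : R), hxy, mul_one]
      _ = _ := by rw [h2]; noncomm_ring
  have hcolj : ∀ j : ℕ, e * (s' ^ j * (y * e)) = g * (-(a * g)) ^ j * e := by
    intro j
    have : s' ^ j * (y * e) = y * e * (-(a * g)) ^ j := by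
      induction j with
      | zero => simp
      | succ j ih => rw [pow_succ, mul_assoc, hcol, neg_mul, ← mul_neg, ← mul_assoc, ih, mul_assoc,
          ← pow_succ]
    rw [this, ← mul_assoc, ← mul_assoc, hg, mul_assoc, mul_assoc,
      ((hae.mul_left hge).neg_left.pow_left j).eq]
  have hrowj : ∀ j : ℕ, e * y * s ^ j * e = (-(g * c)) ^ j * g * e := by
    intro j
    have : e * y * s ^ j = (-(g * c)) ^ j * (e * y) := by
      induction j with
      | zero => simp
      | succ j ih => rw [pow_succ', ← mul_assoc, hrow, mul_assoc, ih, ← mul_assoc, ← pow_succ']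
    rw [this, mul_assoc, hg, ← mul_assoc]
  have hcancel : ∀ α ∈ 𝒜, α * e = e → α = 1 := by
    intro α hα h
    have := hK (α - 1) (sub_mem hα (one_mem _))
    rw [sub_mul, h, one_mul, sub_self, norm_zero, mul_zero] at this
    exact sub_eq_zero.1 (norm_le_zero_iff.1 this)
  have hhg : (b - c * g * a) * g = 1 := by
    apply hcancel _ (mul_mem (sub_mem hbA (mul_mem (mul_mem hcA hgA) haA)) hgA)
    have h1 : e * (x * (y * e)) = e := by rw [← mul_assoc (x : R), hxy, one_mul, hee]
    have h3 := hcolj 1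
    rw [pow_one, pow_one] at h3
    refine Eq.trans ?_ h1
    rw [hx, add_mul, add_mul, mul_add, mul_add, ← mul_assoc e (a * s), ← mul_assoc e a,
      ← hae.eq, mul_assoc a e s, hes, ← mul_assoc e b, ← hbe.eq, mul_assoc b e, ← mul_assoc e y,
      hg, ← hc'.eq, mul_assoc c s', ← mul_assoc e c, ← hce.eq, mul_assoc c e, h3]
    noncomm_ring
  have hgh : g * (b - c * g * a) = 1 := by
    apply hcancel _ (mul_mem hgA (sub_mem hbA (mul_mem (mul_mem hcA hgA) haA)))
    have h1 : e * y * x * e = e := by rw [mul_assoc _ y, hyx, mul_one, hee]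
    have h3 := hrowj 1
    rw [pow_one, pow_one] at h3
    have h4 : e * y * (a * s) * e = -(g * c) * g * a * e := by
      rw [ha.eq, ← mul_assoc, mul_assoc _ a e, hae.eq, ← mul_assoc, h3, mul_assoc _ e a, ← hae.eq,
        ← mul_assoc]
    have h5 : e * y * b * e = g * b * e := by
      rw [mul_assoc _ b e, hbe.eq, ← mul_assoc, hg, mul_assoc, ← hbe.eq, ← mul_assoc]
    have h6 : e * y * (s' * c) * e = 0 := by
      rw [mul_assoc _ _ e, mul_assoc s', hce.eq, ← mul_assoc s', hse]; simp
    refine Eq.trans ?_ h1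
    rw [hx, mul_add, mul_add, add_mul, add_mul, h4, h5, h6]
    noncomm_ring
  set h : Rˣ := ⟨b - c * g * a, g, hhg, hgh⟩ with hh
  refine ⟨h, rfl, rfl, ?_⟩
  have hbound : ∀ α ∈ 𝒜, ∀ z : R, ‖z‖ ≤ K' → (α * e = e * (z * (y * e)) ∨ α * e = e * y * z * e) →
      ‖α‖ ≤ K * (‖e‖ * K' * ‖y‖ * ‖e‖) := by
    intro α hα z hz h
    refine (hK α hα).trans (mul_le_mul_of_nonneg_left ?_ hK0)
    rcases h with h | h <;> rw [h]
    · calc ‖e * (z * (y * e))‖ ≤ ‖e‖ * (‖z‖ * (‖y‖ * ‖e‖)) :=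
            (norm_mul_le _ _).trans (mul_le_mul_of_nonneg_left ((norm_mul_le _ _).trans
              (mul_le_mul_of_nonneg_left (norm_mul_le _ _) (norm_nonneg _))) (norm_nonneg _))
        _ ≤ ‖e‖ * (K' * (‖y‖ * ‖e‖)) := by gcongr
        _ = _ := by ring
    · calc ‖e * y * z * e‖ ≤ ‖e‖ * ‖y‖ * ‖z‖ * ‖e‖ := norm_mul₃_le.trans
            (mul_le_mul_of_nonneg_right (mul_le_mul_of_nonneg_right (norm_mul_le _ _)
              (norm_nonneg _)) (norm_nonneg _))
        _ ≤ ‖e‖ * ‖y‖ * K' * ‖e‖ := by gcongr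
        _ = _ := by ring
  set M := K * (‖e‖ * K' * ‖y‖ * ‖e‖) with hM
  have hK'0 : 0 ≤ K' := (norm_nonneg _).trans (hsb 0)
  have hM0 : 0 ≤ M := by positivity
  have hga : ∀ j : ℕ, ‖(g * a * s) ^ j‖ ≤ (‖(1 : R)‖ + M * ‖a‖) * K' := by
    intro j
    rw [(hgs.mul_left ha).mul_pow]
    refine (norm_mul_le _ _).trans (mul_le_mul ?_ (hsb j) (norm_nonneg _) (by positivity))
    cases j with
    | zero => rw [pow_zero]; exact le_add_of_nonneg_right (by positivity)
    | succ j =>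
      refine le_trans ?_ (le_add_of_nonneg_left (norm_nonneg _))
      rw [show (g * a) ^ (j + 1) = g * (a * g) ^ j * a from by
          rw [pow_succ, ← mul_assoc, mul_pow_mul]]
      refine (norm_mul_le _ _).trans (mul_le_mul_of_nonneg_right ?_ (norm_nonneg _))
      have := hbound _ (mul_mem hgA (pow_mem (neg_mem (mul_mem haA hgA)) j)) _ (hsb' j)
        (Or.inl (hcolj j).symm)
      rcases neg_one_pow_eq_or R j with h | h <;> rw [neg_pow, h] at this <;> simpa using this
  have hcg : ∀ j : ℕ, ‖(s' * (c * g)) ^ j‖ ≤ K' * (‖(1 : R)‖ + ‖c‖ * M) := by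
    intro j
    rw [(hc'.mul_left hgs').symm.mul_pow]
    refine (norm_mul_le _ _).trans (mul_le_mul (hsb' j) ?_ (norm_nonneg _) hK'0)
    cases j with
    | zero => rw [pow_zero]; exact le_add_of_nonneg_right (by positivity)
    | succ j =>
      refine le_trans ?_ (le_add_of_nonneg_left (norm_nonneg _))
      rw [show (c * g) ^ (j + 1) = c * ((g * c) ^ j * g) from by
          rw [pow_succ, ← mul_assoc, mul_pow_mul, mul_assoc]]
      refine (norm_mul_le _ _).trans (mul_le_mul_of_nonneg_left ?_ (norm_nonneg _))
      have := hbound _ (mul_mem (pow_mem (neg_mem (mul_mem hgA hcA)) j) hgA) _ (hsb j)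
        (Or.inr (hrowj j).symm)
      rcases neg_one_pow_eq_or R j with h | h <;> rw [neg_pow, h] at this <;> simpa using this
  have hfactor : (1 + s' * (c * g)) * (b - c * g * a) * (1 + g * a * s) = x := by
    have h1 : (1 + s' * (c * g)) * (b - c * g * a) = b - c * g * a + s' * c := by
      rw [add_mul, one_mul, mul_assoc s', mul_assoc c g (_ - _), hgh, mul_one]
    have h2 : (b - c * g * a) * (g * a * s) = a * s := by
      rw [← mul_assoc, ← mul_assoc, hhg, one_mul]
    have h3 : s' * c * (g * a * s) = c * g * a := by
      rw [mul_assoc s', ← mul_assoc c, ← mul_assoc c, ((hc.mul_left hgs).mul_left ha).eq,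
        ← mul_assoc, hs, one_mul]
    rw [h1, mul_add, mul_one, add_mul, h2, h3, hx]
    abel
  refine joined_units_of_path (f := fun r : ℝ => (1 + (1 - r) • (s' * (c * g))) * (b - c * g * a) *
    (1 + (1 - r) • (g * a * s))) (by fun_prop) ?_ ?_ ?_
  · rintro r ⟨h0, h1⟩
    rcases h0.eq_or_lt with rfl | h0
    · rw [sub_zero, one_smul, one_smul, hfactor]
      exact x.isUnit
    · exact ((isUnit_one_add_smul_of_pow_bounded hcg (by linarith) (by linarith)).mul h.isUnit).mul
        (isUnit_one_add_smul_of_pow_bounded hga (by linarith) (by linarith))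
  · rw [sub_zero, one_smul, one_smul, hfactor]
  · simp [hh]

end Pencil

section MatrixUnits

open Matrix unitInterval

variable {ι κ τ : Type} [Fintype ι] [DecidableEq ι] [Fintype κ] [DecidableEq κ]
  [Fintype τ] [DecidableEq τ]

section Normed

variable {A : Type*} [NormedRing A] [CompleteSpace A]

theorem completeSpace_linfty_matrix :
    @CompleteSpace (Matrix ι ι A)
      (Matrix.linftyOpNormedRing : NormedRing (Matrix ι ι A)).toMetricSpace.toUniformSpace :=
  inferInstanceAs (CompleteSpace (ι → ι → A))

theorem isOpenEmbedding_val_matrix :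
    Topology.IsOpenEmbedding (Units.val : (Matrix ι ι A)ˣ → Matrix ι ι A) := by
  let : NormedRing (Matrix ι ι A) := Matrix.linftyOpNormedRing
  have := completeSpace_linfty_matrix (ι := ι) (A := A)
  exact Units.isOpenEmbedding_val

theorem eventually_isUnit_matrix {x : Matrix ι ι A} (hx : IsUnit x) :
    ∀ᶠ y in nhds x, IsUnit y := by
  obtain ⟨u, rfl⟩ := hx
  filter_upwards [isOpenEmbedding_val_matrix.isOpen_range.mem_nhds ⟨u, rfl⟩] with y hy
  exact hy

end Normed

variable {A : Type*} [Ring A]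

/-- The stabilisation `u ↦ u ⊕ 1`. -/
def stabilize (κ : Type) [Fintype κ] [DecidableEq κ] :
    (Matrix ι ι A)ˣ →* (Matrix (ι ⊕ κ) (ι ⊕ κ) A)ˣ where
  toFun u := ⟨fromBlocks u.val 0 0 1, fromBlocks u⁻¹.val 0 0 1,
    by simp [fromBlocks_multiply, fromBlocks_one], by simp [fromBlocks_multiply, fromBlocks_one]⟩
  map_one' := Units.ext (by simp [fromBlocks_one])
  map_mul' u v := Units.ext (by simp [fromBlocks_multiply])

@[simp] theorem stabilize_val (u : (Matrix ι ι A)ˣ) :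
    (stabilize κ u).val = fromBlocks u.val 0 0 1 := rfl

@[simp] theorem stabilize_inv_val (u : (Matrix ι ι A)ˣ) :
    (stabilize κ u)⁻¹.val = fromBlocks u⁻¹.val 0 0 1 := rfl

/-- The unipotent matrix with upper right block `p`. -/
def upperUnipotent (p : Matrix ι κ A) : (Matrix (ι ⊕ κ) (ι ⊕ κ) A)ˣ :=
  ⟨fromBlocks 1 p 0 1, fromBlocks 1 (-p) 0 1,
    by simp [fromBlocks_multiply, fromBlocks_one], by simp [fromBlocks_multiply, fromBlocks_one]⟩

/-- The unipotent matrix with lower left block `q`. -/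
def lowerUnipotent (q : Matrix κ ι A) : (Matrix (ι ⊕ κ) (ι ⊕ κ) A)ˣ :=
  ⟨fromBlocks 1 0 q 1, fromBlocks 1 0 (-q) 1,
    by simp [fromBlocks_multiply, fromBlocks_one], by simp [fromBlocks_multiply, fromBlocks_one]⟩

/-- Reindexing of invertible matrices. -/
def reindexUnits (e : ι ≃ κ) : (Matrix ι ι A)ˣ →* (Matrix κ κ A)ˣ :=
  Units.map (reindexRingEquiv A e : Matrix ι ι A →* Matrix κ κ A)

theorem stabilize_stabilize (u : (Matrix ι ι A)ˣ) :
    reindexUnits (Equiv.sumAssoc ι κ τ) (stabilize τ (stabilize κ u)) = stabilize (κ ⊕ τ) u := by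
  ext i j
  rcases i with i | i | i <;> rcases j with j | j | j <;>
    simp [reindexUnits, Matrix.one_apply]

variable [TopologicalSpace A]

theorem continuous_stabilize : Continuous (stabilize κ : (Matrix ι ι A)ˣ → _) := by
  rw [Units.continuous_iff]
  constructor
  · exact Units.continuous_val.matrix_fromBlocks continuous_const continuous_const continuous_const
  · exact Units.continuous_coe_inv.matrix_fromBlocks continuous_const continuous_const
      continuous_const

theorem continuous_reindexUnits (e : ι ≃ κ) :
    Continuous (reindexUnits e : (Matrix ι ι A)ˣ → _) := by
  refine Continuous.units_map _ ?_
  exact continuous_id.matrix_reindex e e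

/-- `u` becomes connected to the identity after stabilisation. -/
def StablyTrivial (u : (Matrix ι ι A)ˣ) : Prop :=
  ∃ (κ : Type) (_ : Fintype κ) (_ : DecidableEq κ), Joined (stabilize κ u) 1

/-- Every invertible matrix is stably connected to the identity. -/
def KOneTrivial (A : Type*) [Ring A] [TopologicalSpace A] : Prop :=
  ∀ (ι : Type) [Fintype ι] [DecidableEq ι] (u : (Matrix ι ι A)ˣ), StablyTrivial u

theorem StablyTrivial.of_joined {u v : (Matrix ι ι A)ˣ} (h : Joined u v) (hv : StablyTrivial v) :
    StablyTrivial u := by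
  obtain ⟨κ, _, _, hκ⟩ := hv
  exact ⟨κ, _, _, (h.map continuous_stabilize).trans hκ⟩

theorem StablyTrivial.of_stabilize {u : (Matrix ι ι A)ˣ} (h : StablyTrivial (stabilize κ u)) :
    StablyTrivial u := by
  obtain ⟨τ, _, _, hτ⟩ := h
  refine ⟨κ ⊕ τ, inferInstance, inferInstance, ?_⟩
  have := hτ.map (continuous_reindexUnits (Equiv.sumAssoc ι κ τ))
  rwa [stabilize_stabilize, map_one] at this

variable [IsTopologicalRing A] [Algebra ℝ A] [ContinuousSMul ℝ A]

theorem joined_upperUnipotent (p : Matrix ι κ A) : Joined (upperUnipotent p) 1 := by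
  have : Continuous fun t : I => upperUnipotent ((1 - t : ℝ) • p) := by
    rw [Units.continuous_iff]
    constructor
    · exact continuous_const.matrix_fromBlocks (by fun_prop) continuous_const continuous_const
    · exact continuous_const.matrix_fromBlocks (by fun_prop) continuous_const continuous_const
  exact ⟨⟨⟨_, this⟩, by simp, Units.ext (by simp [upperUnipotent, fromBlocks_one])⟩⟩

theorem joined_lowerUnipotent (q : Matrix κ ι A) : Joined (lowerUnipotent q) 1 := by
  have : Continuous fun t : I => lowerUnipotent ((1 - t : ℝ) • q) := by
    rw [Units.continuous_iff]
    constructor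
    · exact continuous_const.matrix_fromBlocks continuous_const (by fun_prop) continuous_const
    · exact continuous_const.matrix_fromBlocks continuous_const (by fun_prop) continuous_const
  exact ⟨⟨⟨_, this⟩, by simp, Units.ext (by simp [lowerUnipotent, fromBlocks_one])⟩⟩

/-- Higman's trick. -/
theorem exists_joined_of_eq_mul (u : (Matrix ι ι A)ˣ) {P : Matrix ι κ A} {Q : Matrix κ ι A}
    (h : u.val = P * Q) : ∃ w : (Matrix (ι ⊕ κ) (ι ⊕ κ) A)ˣ,
      w.val = fromBlocks 0 P (-Q) 1 ∧ Joined (stabilize κ u) w := by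
  refine ⟨upperUnipotent P * stabilize κ u * lowerUnipotent (-Q), ?_, ?_⟩
  · simp [upperUnipotent, lowerUnipotent, fromBlocks_multiply, h]
  · simpa using (((joined_upperUnipotent P).mul (Joined.refl (stabilize κ u))).mul
      (joined_lowerUnipotent (-Q))).symm

end MatrixUnits

section StepFactor

open Matrix unitInterval

variable {ι : Type} [Fintype ι] [DecidableEq ι]

/-- A matrix with entries in a product of submodules factors accordingly. -/
theorem exists_factor_of_mem_mul {C : Type*} [Ring C] [Algebra ℂ C] {L N : Submodule ℂ C}
    (M : Matrix ι ι C) (hM : ∀ i j, M i j ∈ L * N) :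
    ∃ (κ : Type) (_ : Fintype κ) (_ : DecidableEq κ) (P : Matrix ι κ C) (Q : Matrix κ ι C),
      M = P * Q ∧ (∀ i j, P i j ∈ L) ∧ ∀ i j, Q i j ∈ N := by
  let G : Matrix ι ι C → Prop := fun M =>
    ∃ (κ : Type) (_ : Fintype κ) (_ : DecidableEq κ) (P : Matrix ι κ C) (Q : Matrix κ ι C),
      M = P * Q ∧ (∀ i j, P i j ∈ L) ∧ ∀ i j, Q i j ∈ N
  have hadd : ∀ M M', G M → G M' → G (M + M') := by
    rintro _ _ ⟨κ, _, _, P, Q, rfl, hP, hQ⟩ ⟨κ', _, _, P', Q', rfl, hP', hQ'⟩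
    refine ⟨κ ⊕ κ', inferInstance, inferInstance, fromCols P P', fromRows Q Q', ?_, ?_, ?_⟩
    · rw [fromCols_mul_fromRows]
    · rintro i (j | j)
      · exact hP i j
      · exact hP' i j
    · rintro (i | i) j
      · exact hQ i j
      · exact hQ' i j
  have hzero : G 0 := ⟨Empty, inferInstance, inferInstance, 0, 0, by simp, by simp, by simp⟩
  have hsingle : ∀ i j, ∀ x ∈ L * N, G (Matrix.single i j x) := by
    intro i j x hx
    induction hx using Submodule.mul_induction_on' with
    | mem_mul_mem p hp q hq =>
      refine ⟨Unit, inferInstance, inferInstance, Matrix.single i () p, Matrix.single () j q, ?_,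
        ?_, ?_⟩
      · simp
      · intro a b
        rw [Matrix.single_apply]
        split_ifs
        · exact hp
        · exact zero_mem _
      · intro a b
        rw [Matrix.single_apply]
        split_ifs
        · exact hq
        · exact zero_mem _
    | add x _ y _ hx hy =>
      rw [Matrix.single_add]
      exact hadd _ _ hx hy
  change G M
  rw [Matrix.matrix_eq_sum_single M]
  exact Finset.sum_induction _ G hadd hzero fun i _ =>
    Finset.sum_induction _ G hadd hzero fun j _ => hsingle i j _ (hM i j)

theorem stablyTrivial_of_mem_pow {C : Type*} [Ring C] [Algebra ℂ C] [TopologicalSpace C]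
    [IsTopologicalRing C] [Algebra ℝ C] [ContinuousSMul ℝ C]
    {L : Submodule ℂ C} (h1 : (1 : C) ∈ L)
    (hL : ∀ (ι : Type) [Fintype ι] [DecidableEq ι] (u : (Matrix ι ι C)ˣ),
      (∀ i j, u.val i j ∈ L) → StablyTrivial u) (d : ℕ) :
    ∀ (ι : Type) [Fintype ι] [DecidableEq ι] (u : (Matrix ι ι C)ˣ),
      (∀ i j, u.val i j ∈ L ^ (d + 1)) → StablyTrivial u := by
  induction d with
  | zero => simpa using hL
  | succ d ih =>
    intro ι _ _ u hu
    simp only [pow_succ' L (d + 1)] at hu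
    obtain ⟨κ, _, _, P, Q, hPQ, hP, hQ⟩ := exists_factor_of_mem_mul u.val hu
    obtain ⟨w, hw, hj⟩ := exists_joined_of_eq_mul u hPQ
    have h1' : (1 : Submodule ℂ C) ≤ L := by rwa [Submodule.one_le]
    have hLd : L ≤ L ^ (d + 1) := by
      simpa using pow_le_pow_right₀ h1' (Nat.le_add_left 1 d)
    refine (StablyTrivial.of_joined hj (ih _ w ?_)).of_stabilize
    rw [hw]
    rintro (i | i) (j | j)
    · exact zero_mem _
    · exact hLd (hP i j)
    · exact neg_mem (hQ i j)
    · rw [fromBlocks_apply₂₂, Matrix.one_apply]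
      split_ifs
      · exact hLd h1
      · exact zero_mem _

theorem exists_joined_of_dense {R : Type*} [NormedRing R] [CompleteSpace R] [NormedAlgebra ℝ R]
    {D : Set R} (hD : Dense D) (u : Rˣ) : ∃ v : Rˣ, v.val ∈ D ∧ Joined u v := by
  obtain ⟨ε, hε, hb⟩ := Metric.isOpen_iff.1 (Units.isOpenEmbedding_val (R := R)).isOpen_range
    u.val ⟨u, rfl⟩
  obtain ⟨y, hy, hyD⟩ := hD.exists_mem_open Metric.isOpen_ball ⟨u.val, Metric.mem_ball_self hε⟩
  obtain ⟨v, hv⟩ := hb hyD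
  refine ⟨v, hv ▸ hy, joined_units_of_path (f := fun r => u.val + r • (v.val - u.val))
    (by fun_prop) (fun r hr => ?_) (by simp) (by simp)⟩
  refine hb ((convex_ball u.val ε).add_smul_sub_mem (Metric.mem_ball_self hε) ?_ hr)
  rwa [hv]

theorem exists_joined_matrix_of_dense {C : Type*} [NormedRing C] [CompleteSpace C]
    [NormedAlgebra ℝ C] {D : Set C} (hD : Dense D) (u : (Matrix ι ι C)ˣ) :
    ∃ v : (Matrix ι ι C)ˣ, (∀ i j, v.val i j ∈ D) ∧ Joined u v := by
  let _ : NormedRing (Matrix ι ι C) := Matrix.linftyOpNormedRing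
  let _ : NormedAlgebra ℝ (Matrix ι ι C) := Matrix.linftyOpNormedAlgebra
  have := completeSpace_linfty_matrix (ι := ι) (A := C)
  have hd : Dense {M : Matrix ι ι C | ∀ i j, M i j ∈ D} := by
    have : Dense (Set.pi Set.univ fun _ : ι => Set.pi Set.univ fun _ : ι => D) :=
      dense_pi _ fun _ _ => dense_pi _ fun _ _ => hD
    have hset : {M : Matrix ι ι C | ∀ i j, M i j ∈ D} =
        (Set.pi Set.univ fun _ : ι => Set.pi Set.univ fun _ : ι => D : Set (ι → ι → C)) := by
      ext M
      exact ⟨fun h i _ j _ => h i j, fun h i j => h i trivial j trivial⟩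
    rw [hset]
    exact this
  exact exists_joined_of_dense hd u

end StepFactor

section Step

open Matrix unitInterval

variable {A C : Type*} [NormedRing A] [NormedAlgebra ℂ A] [CompleteSpace A] [NormedRing C]
  [NormedAlgebra ℂ C] [CompleteSpace C]

theorem exists_corner (φ : A →ₐ[ℂ] C) (hφ : Continuous φ) {S S' : C} (hS : S' * S = 1)
    (hc : ∀ a, Commute (φ a) S) (hc' : ∀ a, Commute (φ a) S')
    (hd : Dense (Algebra.adjoin ℂ (Set.range φ ∪ {S, S'}) : Set C)) {K : ℝ}
    (hK : ∀ a, ‖a‖ ≤ K * ‖φ a * (1 - S * S')‖) (y : C) :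
    ∃ a, (1 - S * S') * y * (1 - S * S') = φ a * (1 - S * S') := by
  set e : C := 1 - S * S' with he
  have hes : e * S = 0 := by rw [he, sub_mul, mul_assoc, hS]; simp
  have hse : S' * e = 0 := by rw [he, mul_sub, ← mul_assoc, hS]; simp
  have hee : e * e = e := by
    conv_lhs => rw [he, sub_mul, one_mul, ← he, mul_assoc, hse, mul_zero, sub_zero]
  have hae : ∀ a, Commute (φ a) e := fun a =>
    (Commute.one_right _).sub_right ((hc a).mul_right (hc' a))
  let ψ : A →ₗ[ℂ] C := (LinearMap.mulRight ℂ e).comp φ.toLinearMap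
  have hψ : ∀ a, ψ a = φ a * e := fun a => rfl
  let ψc : A →L[ℂ] C := ⟨ψ, by
    change Continuous fun a => φ a * e
    fun_prop⟩
  have hcl : IsClosed (LinearMap.range ψ : Set C) := by
    have hanti : AntilipschitzWith K.toNNReal ψc := by
      refine AddMonoidHomClass.antilipschitz_of_bound ψc fun a => ?_
      refine (hK a).trans ?_
      exact mul_le_mul_of_nonneg_right (Real.le_coe_toNNReal K) (norm_nonneg _)
    exact hanti.isClosed_range ψc.uniformContinuous
  let D : Submodule ℂ C :=
    { carrier := {y | ∀ j : ℕ, e * S' ^ j * y * e ∈ LinearMap.range ψ}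
      add_mem' := fun {x y} hx hy j => by
        rw [mul_add, add_mul]
        exact add_mem (hx j) (hy j)
      zero_mem' := fun j => by simp
      smul_mem' := fun c x hx j => by
        rw [mul_smul_comm, smul_mul_assoc]
        exact Submodule.smul_mem _ _ (hx j) }
  have hDcl : IsClosed (D : Set C) := by
    have : (D : Set C) =
        ⋂ j : ℕ, (fun y => e * S' ^ j * y * e) ⁻¹' (LinearMap.range ψ : Set C) := by
      ext y
      simp only [Set.mem_iInter, Set.mem_preimage]
      rfl
    rw [this]
    exact isClosed_iInter fun j => hcl.preimage (by fun_prop)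
  have h1 : (1 : C) ∈ D := by
    rintro (_ | j)
    · exact ⟨1, by simp [hψ, hee]⟩
    · simp [pow_succ, mul_assoc, hse]
  have hleft : ∀ x ∈ Algebra.adjoin ℂ (Set.range φ ∪ {S, S'}), ∀ y ∈ D, x * y ∈ D := by
    intro x hx
    induction hx using Algebra.adjoin_induction with
    | mem x hx =>
      rintro y hy j
      rcases hx with ⟨a, rfl⟩ | rfl | rfl
      · obtain ⟨b, hb⟩ := hy j
        refine ⟨a * b, ?_⟩
        rw [hψ, map_mul, mul_assoc, ← hψ, hb]
        have : Commute (φ a) (e * S' ^ j) := (hae a).mul_right ((hc' a).pow_right j)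
        simp only [← mul_assoc]
        rw [mul_assoc (φ a), this.eq]
      · rcases j with _ | j
        · rw [pow_zero, mul_one, ← mul_assoc, hes]
          simp
        · have := hy j
          have hpow : S' ^ (j + 1) * (x * y) = S' ^ j * y := by
            rw [pow_succ, mul_assoc, ← mul_assoc S', hS, one_mul]
          rwa [mul_assoc e, hpow, ← mul_assoc]
      · have := hy (j + 1)
        rw [pow_succ] at this
        simpa only [mul_assoc] using this
    | algebraMap r =>
      intro y hy
      rw [← Algebra.smul_def]
      exact D.smul_mem r hy
    | add x x' _ _ hx hx' =>
      intro y hy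
      rw [add_mul]
      exact add_mem (hx y hy) (hx' y hy)
    | mul x x' _ _ hx hx' =>
      intro y hy
      rw [mul_assoc]
      exact hx _ (hx' y hy)
  have hy : y ∈ closure (Algebra.adjoin ℂ (Set.range φ ∪ {S, S'}) : Set C) := hd y
  have hyD : y ∈ D := closure_minimal (fun x hx => by simpa using hleft x hx 1 h1) hDcl hy
  obtain ⟨a, ha⟩ := hyD 0
  exact ⟨a, by rw [← hψ, ha, pow_zero, mul_one]⟩

theorem kOneTrivial_of_tridiagonal (φ : A →ₐ[ℂ] C) (hφ : Continuous φ) {S S' : C}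
    (hS : S' * S = 1) (hc : ∀ a, Commute (φ a) S) (hc' : ∀ a, Commute (φ a) S')
    (hd : Dense (Algebra.adjoin ℂ (Set.range φ ∪ {S, S'}) : Set C)) {K : ℝ} (hK0 : 0 ≤ K)
    (hK : ∀ a, ‖φ a‖ ≤ K * ‖φ a * (1 - S * S')‖) (hiso : ∀ a, ‖a‖ ≤ ‖φ a‖)
    {K' : ℝ} (hsb : ∀ j : ℕ, ‖S ^ j‖ ≤ K') (hsb' : ∀ j : ℕ, ‖S' ^ j‖ ≤ K')
    (hA : KOneTrivial A) {ι : Type} [Fintype ι] [DecidableEq ι] (u : (Matrix ι ι C)ˣ)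
    {a b c : Matrix ι ι A}
    (hu : ∀ i j, u.val i j = φ (a i j) * S + φ (b i j) + S' * φ (c i j)) : StablyTrivial u := by
  let _ : NormedRing (Matrix ι ι C) := Matrix.linftyOpNormedRing
  let _ : NormedAlgebra ℝ (Matrix ι ι C) := Matrix.linftyOpNormedAlgebra
  have := completeSpace_linfty_matrix (ι := ι) (A := C)
  have hinj : Function.Injective φ := by
    refine (injective_iff_map_eq_zero φ).2 fun x hx => ?_
    have := hiso x
    rw [hx, norm_zero] at this
    exact norm_le_zero_iff.1 this
  choose g hg using exists_corner φ hφ hS hc hc' hd (K := K) fun a => (hiso a).trans (hK a)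
  let s : Matrix ι ι C := diagonal fun _ => S
  let s' : Matrix ι ι C := diagonal fun _ => S'
  have hss : 1 - s * s' = diagonal fun _ => 1 - S * S' := by
    rw [diagonal_mul_diagonal, ← diagonal_one, diagonal_sub]
  let Φ : Matrix ι ι A →ₐ[ℂ] Matrix ι ι C := φ.mapMatrix
  have hcs : ∀ M, Commute (Φ M) s := fun M => by
    ext i j
    simpa [s, Φ] using (hc (M i j)).eq
  have hcs' : ∀ M, Commute (Φ M) s' := fun M => by
    ext i j
    simpa [s', Φ] using (hc' (M i j)).eq
  let G : Matrix ι ι A := Matrix.of fun i j => g (u⁻¹.val i j)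
  have hpow : ∀ (T : C), (∀ j : ℕ, ‖T ^ j‖ ≤ K') →
      ∀ j : ℕ, ‖(diagonal fun _ : ι => T) ^ j‖ ≤ K' := by
    intro T hT j
    rw [diagonal_pow, linfty_opNorm_diagonal]
    exact (pi_norm_le_iff_of_nonneg ((norm_nonneg _).trans (hT 0))).2 fun i => hT j
  obtain ⟨h, hh, hh', hj⟩ := joined_schur_of_pencil (s := s) (s' := s') (a := Φ a) (b := Φ b)
    (c := Φ c) (g := Φ G) u (by
      rw [diagonal_mul_diagonal, hS, diagonal_one]) (hcs _) (hcs' _) (hcs _) (hcs _) (hcs' _)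
      (hcs _) (hcs' _) (hcs' _) (by
        ext i j
        simp [hu, s, s', Φ]) (by
        rw [hss]
        ext i j
        simp [Φ, G, hg]) Φ.range.toSubring ⟨_, rfl⟩ ⟨_, rfl⟩ ⟨_, rfl⟩ ⟨_, rfl⟩ hK0 (by
        rintro _ ⟨M, rfl⟩
        rw [hss, linfty_opNorm_def, linfty_opNorm_def]
        lift K to NNReal using hK0
        norm_cast
        refine Finset.sup_le fun i hi => ?_
        refine le_trans ?_ (mul_le_mul_right (Finset.le_sup hi) K)
        rw [Finset.mul_sum]
        refine Finset.sum_le_sum fun j _ => ?_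
        have := hK (M i j)
        simpa [Φ, ← NNReal.coe_le_coe] using this) (hpow S hsb) (hpow S' hsb')
  have hΦ : Function.Injective Φ := fun M N hMN => by
    ext i j
    exact hinj (congrFun (congrFun hMN i) j)
  let h₀ : (Matrix ι ι A)ˣ :=
    ⟨b - c * G * a, G, hΦ (by
      rw [map_mul, map_one, map_sub, map_mul, map_mul, ← hh, ← hh', h.mul_inv]), hΦ (by
      rw [map_mul, map_one, map_sub, map_mul, map_mul, ← hh, ← hh', h.inv_mul])⟩
  obtain ⟨κ, _, _, hκ⟩ := hA ι h₀
  refine StablyTrivial.of_joined hj ⟨κ, inferInstance, inferInstance, ?_⟩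
  have hcont : Continuous (Units.map (φ.mapMatrix (m := ι ⊕ κ)).toRingHom.toMonoidHom) :=
    Continuous.units_map _ (continuous_id.matrix_map hφ)
  have := hκ.map hcont
  rw [map_one] at this
  convert this using 1
  ext i j
  rcases i with i | i <;> rcases j with j | j
  · have : h.val = Φ (b - c * G * a) := by
      rw [hh, map_sub, map_mul, map_mul]
    simp [this, h₀, Φ]
  · simp
  · simp
  · simp [Matrix.one_apply, apply_ite φ]

/-- If `C` is generated by `A` and a commuting shift, then triviality of `K₁` passes from `A`
to `C`. -/
theorem KOneTrivial.of_shift (hA : KOneTrivial A) (φ : A →ₐ[ℂ] C) (hφ : Continuous φ) {S S' : C}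
    (hS : S' * S = 1) (hc : ∀ a, Commute (φ a) S) (hc' : ∀ a, Commute (φ a) S')
    (hd : Dense (Algebra.adjoin ℂ (Set.range φ ∪ {S, S'}) : Set C)) {K : ℝ} (hK0 : 0 ≤ K)
    (hK : ∀ a, ‖φ a‖ ≤ K * ‖φ a * (1 - S * S')‖) (hiso : ∀ a, ‖a‖ ≤ ‖φ a‖)
    {K' : ℝ} (hsb : ∀ j : ℕ, ‖S ^ j‖ ≤ K') (hsb' : ∀ j : ℕ, ‖S' ^ j‖ ≤ K') : KOneTrivial C := by
  let Λ : (A × A × A) →ₗ[ℂ] C :=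
    { toFun := fun p => φ p.1 * S + φ p.2.1 + S' * φ p.2.2
      map_add' := fun p q => by simp [add_mul, mul_add]; abel
      map_smul' := fun r p => by simp [smul_add] }
  let L := LinearMap.range Λ
  have hL1 : (1 : C) ∈ L := ⟨(0, 1, 0), by simp [Λ]⟩
  have h1' : (1 : Submodule ℂ C) ≤ L := by rwa [Submodule.one_le]
  have hL : ∀ (ι : Type) [Fintype ι] [DecidableEq ι] (u : (Matrix ι ι C)ˣ),
      (∀ i j, u.val i j ∈ L) → StablyTrivial u := by
    intro ι _ _ u hu
    choose p hp using hu
    exact kOneTrivial_of_tridiagonal φ hφ hS hc hc' hd hK0 hK hiso hsb hsb' hA u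
      (a := fun i j => (p i j).1) (b := fun i j => (p i j).2.1) (c := fun i j => (p i j).2.2)
      fun i j => (hp i j).symm
  have hpow : ∀ x ∈ Algebra.adjoin ℂ (Set.range φ ∪ {S, S'}), ∃ d : ℕ, x ∈ L ^ (d + 1) := by
    intro x hx
    induction hx using Algebra.adjoin_induction with
    | mem x hx =>
      refine ⟨0, ?_⟩
      rw [zero_add, pow_one]
      rcases hx with ⟨a, rfl⟩ | rfl | rfl
      · exact ⟨(0, a, 0), by simp [Λ]⟩
      · exact ⟨(1, 0, 0), by simp [Λ]⟩
      · exact ⟨(0, 0, 1), by simp [Λ]⟩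
    | algebraMap r =>
      refine ⟨0, ?_⟩
      rw [zero_add, pow_one, Algebra.algebraMap_eq_smul_one]
      exact L.smul_mem r hL1
    | add x y _ _ hx hy =>
      obtain ⟨d, hd⟩ := hx
      obtain ⟨d', hd'⟩ := hy
      exact ⟨d + d', add_mem (pow_le_pow_right₀ h1' (by omega) hd)
        (pow_le_pow_right₀ h1' (by omega) hd')⟩
    | mul x y _ _ hx hy =>
      obtain ⟨d, hd⟩ := hx
      obtain ⟨d', hd'⟩ := hy
      refine ⟨d + 1 + d', ?_⟩
      rw [add_assoc, pow_add]
      exact Submodule.mul_mem_mul hd hd'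
  intro ι _ _ u
  obtain ⟨v, hv, huv⟩ := exists_joined_matrix_of_dense hd u
  refine StablyTrivial.of_joined huv ?_
  choose d hd using fun i j => hpow _ (hv i j)
  refine stablyTrivial_of_mem_pow hL1 hL (∑ i, ∑ j, d i j) ι v fun i j => ?_
  refine pow_le_pow_right₀ h1' (Nat.add_le_add_right ?_ 1) (hd i j)
  exact (Finset.single_le_sum (f := fun j => d i j) (fun _ _ => Nat.zero_le _)
    (Finset.mem_univ j)).trans (Finset.single_le_sum (f := fun i => ∑ j, d i j)
      (fun _ _ => Nat.zero_le _) (Finset.mem_univ i))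

end Step

section Shifts

open Matrix unitInterval

variable {n : ℕ}

theorem inner_delta_left (z : Fin n → ℕ) (f : Hn n) : inner ℂ (delta z) f = f z := by
  rw [delta, lp.inner_single_left]
  simp

theorem delta_apply (z w : Fin n → ℕ) : delta z w = if w = z then 1 else 0 := by
  rw [delta, lp.single_apply, Pi.single_apply]

theorem orthonormal_delta : Orthonormal ℂ (delta : (Fin n → ℕ) → Hn n) := by
  rw [orthonormal_iff_ite]
  intro z w
  rw [inner_delta_left, delta_apply]

theorem clm_ext_delta {F : Type*} [NormedAddCommGroup F] [NormedSpace ℂ F] {T T' : Hn n →L[ℂ] F}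
    (h : ∀ z, T (delta z) = T' (delta z)) : T = T' :=
  lp.ext_continuousLinearMap (by simp) fun z => ContinuousLinearMap.ext_ring (h z)

/-- The isometry sending the standard basis to a given orthonormal family. -/
def isometryOfOrthonormal {E : Type*} [NormedAddCommGroup E] [InnerProductSpace ℂ E]
    [CompleteSpace E] {v : (Fin n → ℕ) → E} (hv : Orthonormal ℂ v) : Hn n →ₗᵢ[ℂ] E :=
  hv.orthogonalFamily.linearIsometry

theorem isometryOfOrthonormal_delta {E : Type*} [NormedAddCommGroup E] [InnerProductSpace ℂ E]
    [CompleteSpace E] {v : (Fin n → ℕ) → E} (hv : Orthonormal ℂ v) (z : Fin n → ℕ) :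
    isometryOfOrthonormal hv (delta z) = v z := by
  simp [isometryOfOrthonormal, delta]

/-- The isometry `δ_z ↦ δ_{z + c}`. -/
def shift (c : Fin n → ℕ) : Hn n →L[ℂ] Hn n :=
  (isometryOfOrthonormal
    (orthonormal_delta.comp (fun z => z + c) (add_left_injective c))).toContinuousLinearMap

@[simp] theorem shift_delta (c z : Fin n → ℕ) : shift c (delta z) = delta (z + c) :=
  isometryOfOrthonormal_delta (orthonormal_delta.comp _ (add_left_injective c)) z

theorem norm_shift_apply (c : Fin n → ℕ) (f : Hn n) : ‖shift c f‖ = ‖f‖ :=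
  LinearIsometry.norm_map _ f

theorem shift_zero : shift (0 : Fin n → ℕ) = 1 := clm_ext_delta fun z => by simp

theorem shift_add (c d : Fin n → ℕ) : shift (c + d) = shift c * shift d :=
  clm_ext_delta fun z => by simp [add_comm, add_left_comm]

theorem star_shift_mul_shift (c : Fin n → ℕ) : star (shift c) * shift c = 1 :=
  LinearIsometry.adjoint_comp_self _

theorem commute_shift (c d : Fin n → ℕ) : Commute (shift c) (shift d) := by
  rw [Commute, SemiconjBy, ← shift_add, ← shift_add, add_comm]

theorem star_shift_apply (c : Fin n → ℕ) (f : Hn n) (z : Fin n → ℕ) :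
    (star (shift c) f : Hn n) z = f (z + c) := by
  rw [← inner_delta_left, ContinuousLinearMap.star_eq_adjoint,
    ContinuousLinearMap.adjoint_inner_right, shift_delta, inner_delta_left]

theorem star_shift_delta_add (c z : Fin n → ℕ) : star (shift c) (delta (z + c)) = delta z := by
  rw [← shift_delta, ← mul_apply_eq_comp, star_shift_mul_shift,
    one_apply_eq_self]

theorem star_shift_delta_of_not_le {c z : Fin n → ℕ} (h : ¬ c ≤ z) :
    star (shift c) (delta z) = 0 := by
  ext w
  rw [star_shift_apply, delta_apply, if_neg]
  · rfl
  · rintro rfl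
    exact h (le_add_of_nonneg_left (Pi.le_def.2 fun _ => Nat.zero_le _))

theorem norm_shift_le (c : Fin n → ℕ) : ‖shift c‖ ≤ 1 :=
  LinearIsometry.norm_toContinuousLinearMap_le _

theorem norm_star_shift_le (c : Fin n → ℕ) : ‖star (shift c)‖ ≤ 1 := by
  exact (norm_star (shift c)).trans_le (norm_shift_le c)

theorem isShift_iff {i : Fin n} {T : Hn n →L[ℂ] Hn n} :
    IsShift i T ↔ T = shift (Pi.single i 1) := by
  have h : ∀ z : Fin n → ℕ, Function.update z i (z i + 1) = z + Pi.single i 1 := fun z => by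
    ext j
    rcases eq_or_ne j i with rfl | hj
    · simp
    · simp [hj]
  simp only [IsShift, h]
  refine ⟨fun hT => clm_ext_delta fun z => by rw [hT, shift_delta], ?_⟩
  rintro rfl z
  exact shift_delta _ z

theorem shift_star_shift_of_ne {i j : Fin n} (h : i ≠ j) :
    Commute (shift (Pi.single i 1)) (star (shift (Pi.single j 1)) : Hn n →L[ℂ] Hn n) := by
  refine clm_ext_delta fun z => ?_
  simp only [mul_apply_eq_comp, shift_delta]
  by_cases hz : Pi.single j 1 ≤ z
  · obtain ⟨w, rfl⟩ := le_iff_exists_add'.1 hz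
    rw [star_shift_delta_add, shift_delta, add_right_comm, star_shift_delta_add]
  · rw [star_shift_delta_of_not_le hz, map_zero, star_shift_delta_of_not_le]
    intro hz'
    apply hz
    intro k
    have := hz' k
    rcases eq_or_ne k j with rfl | hk
    · simpa [Pi.single_eq_of_ne h.symm] using this
    · simp [hk]

/-- The closed star subalgebra generated by the first `j` shifts. -/
def partialToeplitz (n j : ℕ) : StarSubalgebra ℂ (Hn n →L[ℂ] Hn n) :=
  (StarAlgebra.adjoin ℂ
    {T : Hn n →L[ℂ] Hn n | ∃ i : Fin n, i.val < j ∧ T = shift (Pi.single i 1)}).topologicalClosure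

theorem toeplitz_eq : Toeplitz n = partialToeplitz n n := by
  simp [Toeplitz, partialToeplitz, isShift_iff]

theorem shift_single_mem_partialToeplitz {i : Fin n} {j : ℕ} (h : i.val < j) :
    shift (Pi.single i 1) ∈ partialToeplitz n j :=
  StarSubalgebra.le_topologicalClosure _ (StarAlgebra.subset_adjoin ℂ _ ⟨i, h, rfl⟩)

theorem shift_mem_toeplitz (c : Fin n → ℕ) : shift c ∈ Toeplitz n := by
  have hc : c = ∑ i, c i • (Pi.single i 1 : Fin n → ℕ) := by
    ext j
    simp [Finset.sum_apply, Pi.single_apply]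
  let M : AddSubmonoid (Fin n → ℕ) :=
    { carrier := {c | shift c ∈ Toeplitz n}
      zero_mem' := by
        change shift 0 ∈ Toeplitz n
        rw [shift_zero]
        exact one_mem _
      add_mem' := fun {a b} ha hb => by
        change shift (a + b) ∈ Toeplitz n
        rw [shift_add]
        exact mul_mem ha hb }
  change c ∈ M
  rw [hc]
  refine sum_mem fun i _ => nsmul_mem ?_ _
  change shift (Pi.single i 1) ∈ Toeplitz n
  rw [toeplitz_eq]
  exact shift_single_mem_partialToeplitz i.2

instance (j : ℕ) : CompleteSpace (partialToeplitz n j) :=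
  inferInstanceAs (CompleteSpace (StarSubalgebra.topologicalClosure _))

instance : CompleteSpace (Toeplitz n) :=
  inferInstanceAs (CompleteSpace (StarSubalgebra.topologicalClosure _))

theorem isClosed_partialToeplitz (j : ℕ) :
    IsClosed (partialToeplitz n j : Set (Hn n →L[ℂ] Hn n)) :=
  StarSubalgebra.isClosed_topologicalClosure _

instance (j : ℕ) : IsClosed (partialToeplitz n j : Set (Hn n →L[ℂ] Hn n)) :=
  isClosed_partialToeplitz j

theorem partialToeplitz_mono (j : ℕ) : partialToeplitz n j ≤ partialToeplitz n (j + 1) := by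
  refine StarSubalgebra.topologicalClosure_minimal (StarAlgebra.adjoin_le ?_)
    (isClosed_partialToeplitz _)
  rintro _ ⟨i, hi, rfl⟩
  exact shift_single_mem_partialToeplitz (by omega)

theorem commute_of_mem_partialToeplitz {j : ℕ} (hj : j < n) {x : Hn n →L[ℂ] Hn n}
    (hx : x ∈ partialToeplitz n j) : Commute x (shift (Pi.single ⟨j, hj⟩ 1)) ∧
      Commute x (star (shift (Pi.single ⟨j, hj⟩ 1))) := by
  have hle : partialToeplitz n j ≤ StarSubalgebra.centralizer ℂ {shift (Pi.single ⟨j, hj⟩ 1)} := by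
    refine StarSubalgebra.topologicalClosure_minimal (StarAlgebra.adjoin_le ?_)
      (Set.isClosed_centralizer _)
    rintro _ ⟨i, hi, rfl⟩
    rw [SetLike.mem_coe, StarSubalgebra.mem_centralizer_iff]
    rintro _ rfl
    refine ⟨(commute_shift _ _).eq, (shift_star_shift_of_ne ?_).symm.eq⟩
    rintro rfl
    simp at hi
  have := (StarSubalgebra.mem_centralizer_iff ℂ).1 (hle hx) _ rfl
  exact ⟨this.1.symm, this.2.symm⟩

theorem eq_zero_of_mul_corner {i : Fin n} {x : Hn n →L[ℂ] Hn n}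
    (hx : Commute x (shift (Pi.single i 1)))
    (h0 : x * (1 - shift (Pi.single i 1) * star (shift (Pi.single i 1))) = 0) : x = 0 := by
  refine clm_ext_delta fun z => ?_
  rw [_root_.zero_apply]
  obtain ⟨k, hk⟩ : ∃ k, z i = k := ⟨_, rfl⟩
  induction k generalizing z with
  | zero =>
    have := congrArg (fun T : Hn n →L[ℂ] Hn n => T (delta z)) h0
    simp only [mul_apply_eq_comp, _root_.sub_apply,
      one_apply_eq_self, _root_.zero_apply] at this
    rwa [star_shift_delta_of_not_le, map_zero, sub_zero] at this
    intro h
    have := h i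
    simp [hk] at this
  | succ k ih =>
    have hz : Pi.single i 1 ≤ z := by
      intro j
      rcases eq_or_ne j i with rfl | hj
      · simp [hk]
      · simp [hj]
    obtain ⟨w, rfl⟩ := le_iff_exists_add'.1 hz
    rw [← shift_delta, ← mul_apply_eq_comp, hx.eq, mul_apply_eq_comp,
      ih w, map_zero]
    simpa using hk

theorem norm_le_norm_mul_corner {j : ℕ} (hj : j < n) {x : Hn n →L[ℂ] Hn n}
    (hx : x ∈ partialToeplitz n j) :
    ‖x‖ ≤ ‖x * (1 - shift (Pi.single ⟨j, hj⟩ 1) * star (shift (Pi.single ⟨j, hj⟩ 1)))‖ := by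
  set S : Hn n →L[ℂ] Hn n := shift (Pi.single ⟨j, hj⟩ 1) with hS
  set e : Hn n →L[ℂ] Hn n := 1 - S * star S with he
  have hSS : star S * S = 1 := star_shift_mul_shift _
  have hse : star S * e = 0 := by rw [he, mul_sub, ← mul_assoc, hSS]; simp
  have hee : e * e = e := by
    conv_lhs => rw [he, sub_mul, one_mul, ← he, mul_assoc, hse, mul_zero, sub_zero]
  have hes : star e = e := by simp [he]
  have hxe : ∀ {x}, x ∈ partialToeplitz n j → Commute x e := fun hx =>
    have h := commute_of_mem_partialToeplitz hj hx
    (Commute.one_right _).sub_right (h.1.mul_right h.2)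
  let Ψ : partialToeplitz n j →⋆ₙₐ[ℂ] (Hn n →L[ℂ] Hn n) :=
    { toFun := fun x => x.val * e
      map_smul' := fun r x => by simp
      map_zero' := by simp
      map_add' := fun x y => by simp [add_mul]
      map_mul' := fun x y => by
        rw [MulMemClass.coe_mul, mul_assoc x.val e, ← mul_assoc e, ← (hxe y.2).eq, mul_assoc y.val,
          hee, mul_assoc]
      map_star' := fun x => by
        rw [star_mul, hes, StarMemClass.coe_star, (hxe (star_mem x.2)).eq] }
  have hΨ : Function.Injective Ψ := by
    refine (injective_iff_map_eq_zero Ψ).2 fun x hx => Subtype.ext ?_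
    exact eq_zero_of_mul_corner (commute_of_mem_partialToeplitz hj x.2).1 hx
  exact ((NonUnitalStarAlgHom.isometry Ψ hΨ).norm_map_of_map_zero (map_zero Ψ) ⟨x, hx⟩).ge

theorem KOneTrivial.starSubalgebra {E : Type*} [NormedRing E] [NormedAlgebra ℂ E] [StarRing E]
    [StarModule ℂ E] {A B : StarSubalgebra ℂ E} [CompleteSpace A] [CompleteSpace B] (hAB : A ≤ B)
    {S : E} (hS : S ∈ B) (hSS : star S * S = 1)
    (hc : ∀ a ∈ A, Commute a S ∧ Commute a (star S))
    (hK : ∀ a ∈ A, ‖a‖ ≤ ‖a * (1 - S * star S)‖) (hsb : ∀ k : ℕ, ‖S ^ k‖ ≤ 1)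
    (hsb' : ∀ k : ℕ, ‖star S ^ k‖ ≤ 1)
    (hd : (B : Set E) ⊆ closure (Algebra.adjoin ℂ ((A : Set E) ∪ {S, star S}) : Set E))
    (h : KOneTrivial A) : KOneTrivial B := by
  let T : B := ⟨S, hS⟩
  let φ := StarSubalgebra.inclusion hAB
  have hcont : Continuous φ.toAlgHom := continuous_induced_rng.2 continuous_subtype_val
  refine h.of_shift φ.toAlgHom hcont (S := T) (S' := star T) (K := 1) (K' := 1) (Subtype.ext hSS)
    (fun a => Subtype.ext (hc a a.2).1.eq) (fun a => Subtype.ext (hc a a.2).2.eq) ?_ zero_le_one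
    (fun a => ?_) (fun a => le_rfl) (fun k => hsb k) (fun k => hsb' k)
  · intro y
    rw [closure_subtype]
    refine closure_mono ?_ (hd y.2)
    have hsub : Algebra.adjoin ℂ ((A : Set E) ∪ {S, star S}) ≤
        (Algebra.adjoin ℂ (Set.range φ.toAlgHom ∪ {T, star T})).map B.subtype.toAlgHom := by
      refine Algebra.adjoin_le ?_
      rintro x (hx | rfl | rfl)
      · exact ⟨φ ⟨x, hx⟩, Algebra.subset_adjoin (Or.inl ⟨_, rfl⟩), rfl⟩
      · exact ⟨T, Algebra.subset_adjoin (Or.inr (Or.inl rfl)), rfl⟩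
      · exact ⟨star T, Algebra.subset_adjoin (Or.inr (Or.inr rfl)), rfl⟩
    exact fun x hx => hsub hx
  · rw [one_mul]
    exact hK a a.2

theorem KOneTrivial.partialToeplitz_succ {j : ℕ} (hj : j < n)
    (h : KOneTrivial (partialToeplitz n j)) : KOneTrivial (partialToeplitz n (j + 1)) := by
  have hpow : ∀ T : Hn n →L[ℂ] Hn n, ‖T‖ ≤ 1 → ∀ k : ℕ, ‖T ^ k‖ ≤ 1 := by
    intro T hT k
    induction k with
    | zero => exact ContinuousLinearMap.norm_id_le
    | succ k ih =>
      rw [pow_succ]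
      exact (norm_mul_le _ _).trans (mul_le_one₀ ih (norm_nonneg _) hT)
  refine KOneTrivial.starSubalgebra (partialToeplitz_mono j)
    (shift_single_mem_partialToeplitz (i := ⟨j, hj⟩) (Nat.lt_succ_self j)) (star_shift_mul_shift _)
    (fun a ha => commute_of_mem_partialToeplitz hj ha) (fun a ha => norm_le_norm_mul_corner hj ha)
    (hpow _ (norm_shift_le _)) (hpow _ (norm_star_shift_le _)) (closure_mono ?_) h
  have hsub : (StarAlgebra.adjoin ℂ {T : Hn n →L[ℂ] Hn n |
      ∃ i : Fin n, i.val < j + 1 ∧ T = shift (Pi.single i 1)}).toSubalgebra ≤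
        Algebra.adjoin ℂ ((partialToeplitz n j : Set (Hn n →L[ℂ] Hn n)) ∪
          {shift (Pi.single ⟨j, hj⟩ 1), star (shift (Pi.single ⟨j, hj⟩ 1))}) := by
    rw [StarAlgebra.adjoin_toSubalgebra]
    refine Algebra.adjoin_le ?_
    rintro T (⟨i, hi, rfl⟩ | ⟨i, hi, hT⟩)
    · rcases Nat.lt_succ_iff_lt_or_eq.1 hi with hi | rfl
      · exact Algebra.subset_adjoin (Or.inl (shift_single_mem_partialToeplitz hi))
      · exact Algebra.subset_adjoin (Or.inr (Or.inl rfl))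
    · rw [← star_star T, hT]
      rcases Nat.lt_succ_iff_lt_or_eq.1 hi with hi | rfl
      · exact Algebra.subset_adjoin (Or.inl (star_mem (shift_single_mem_partialToeplitz hi)))
      · exact Algebra.subset_adjoin (Or.inr (Or.inr rfl))
  exact fun x hx => hsub hx

theorem joined_one_of_complex {ι : Type} [Fintype ι] [DecidableEq ι] (u : (Matrix ι ι ℂ)ˣ) :
    Joined u 1 := by
  let p : Polynomial ℂ := (1 + (Polynomial.X : Polynomial ℂ) •
    ((u.val - 1).map Polynomial.C) : Matrix ι ι (Polynomial ℂ)).det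
  have hp : ∀ z : ℂ, p.eval z = (1 + z • (u.val - 1)).det := by
    intro z
    rw [← Polynomial.coe_evalRingHom, RingHom.map_det]
    congr 1
    ext i j
    simp only [RingHom.mapMatrix_apply, Matrix.map_apply, Matrix.add_apply, Matrix.smul_apply,
      Polynomial.coe_evalRingHom, Polynomial.eval_add, smul_eq_mul, Polynomial.eval_mul,
      Polynomial.eval_X, Polynomial.eval_C]
    rw [Matrix.one_apply, Matrix.one_apply]
    split_ifs <;> simp
  have hp0 : p.eval 0 = 1 := by simp [hp]
  have hp1 : p.eval 1 ≠ 0 := by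
    rw [hp, one_smul, add_sub_cancel]
    exact ((Matrix.isUnit_iff_isUnit_det _).1 u.isUnit).ne_zero
  have hpne : p ≠ 0 := by
    rintro h
    simp [h] at hp0
  have hpc : IsPathConnected ({z | p.eval z = 0} : Set ℂ)ᶜ := by
    refine Set.Countable.isPathConnected_compl_of_one_lt_rank ?_ ?_
    · simp [Complex.rank_real_complex]
    · refine (p.rootSet_finite ℂ).countable.mono fun z hz => ?_
      rw [Polynomial.mem_rootSet]
      exact ⟨hpne, by simpa using hz⟩
  have hj := hpc.joinedIn 0 (by simp [hp0]) 1 hp1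
  obtain ⟨γ, hγ⟩ := hj
  have hunit : ∀ t, IsUnit (1 + γ t • (u.val - 1)) := fun t => by
    rw [Matrix.isUnit_iff_isUnit_det, ← hp]
    exact isUnit_iff_ne_zero.2 (hγ t)
  have hcont : Continuous fun t => (hunit t).unit := by
    rw [isOpenEmbedding_val_matrix.isEmbedding.continuous_iff]
    exact continuous_const.add (γ.continuous.smul continuous_const)
  exact Joined.symm ⟨⟨⟨_, hcont⟩, Units.ext (by simp), Units.ext (by simp)⟩⟩

theorem kOneTrivial_of_bijective {A : Type*} [NormedRing A] [NormedAlgebra ℂ A]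
    (hA : Function.Bijective (algebraMap ℂ A)) : KOneTrivial A := by
  intro ι _ _ u
  let e : Matrix ι ι ℂ ≃+* Matrix ι ι A := (RingEquiv.ofBijective _ hA).mapMatrix
  have hj := joined_one_of_complex (stabilize Empty (Units.map e.symm.toRingHom.toMonoidHom u))
  refine ⟨Empty, inferInstance, inferInstance, ?_⟩
  have hcont : Continuous (Units.map ((algebraMap ℂ A).mapMatrix (m := ι ⊕ Empty)).toMonoidHom) :=
    Continuous.units_map _ (continuous_id.matrix_map (continuous_algebraMap ℂ A))
  have := hj.map hcont
  rw [map_one] at this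
  convert this using 1
  ext i j
  rcases i with i | i
  · rcases j with j | j
    · have : e (e.symm u.val) i j = u.val i j := by rw [e.apply_symm_apply]
      exact this.symm
    · exact j.elim
  · exact i.elim

theorem kOneTrivial_partialToeplitz (j : ℕ) (hj : j ≤ n) : KOneTrivial (partialToeplitz n j) := by
  induction j with
  | zero =>
    apply kOneTrivial_of_bijective
    have : Nontrivial (Hn n) := ⟨delta 0, 0, orthonormal_delta.ne_zero 0⟩
    refine ⟨(algebraMap ℂ _).injective, fun x => ?_⟩
    have hb : partialToeplitz n 0 ≤ ⊥ := by
      refine StarSubalgebra.topologicalClosure_minimal (StarAlgebra.adjoin_le ?_) ?_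
      · rintro _ ⟨i, hi, -⟩
        exact absurd hi (Nat.not_lt_zero _)
      · have : FiniteDimensional ℂ (⊥ : Subalgebra ℂ (Hn n →L[ℂ] Hn n)) := inferInstance
        exact Submodule.closed_of_finiteDimensional
          (Subalgebra.toSubmodule (⊥ : Subalgebra ℂ (Hn n →L[ℂ] Hn n)))
    obtain ⟨r, hr⟩ := StarSubalgebra.mem_bot.1 (hb x.2)
    exact ⟨r, Subtype.ext hr⟩
  | succ j ih => exact (ih (by omega)).partialToeplitz_succ (by omega)

theorem kOneTrivial_toeplitz : KOneTrivial (Toeplitz n) := by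
  rw [toeplitz_eq]
  exact kOneTrivial_partialToeplitz n le_rfl

end Shifts

section Corner

open Matrix Filter Topology

variable {ι : Type} [Fintype ι] [DecidableEq ι]

/-- `1 + x` for `x` of square zero. -/
def unitOfSqZero {R : Type*} [Ring R] {x : R} (h : x * x = 0) : Rˣ :=
  ⟨1 + x, 1 - x, by simp [mul_sub, add_mul, h], by simp [mul_add, sub_mul, h]⟩

theorem vecMulVec_mulVec_apply {B : Type*} [Ring B] (a r v : ι → B) (i : ι) :
    (vecMulVec a r *ᵥ v) i = a i * (r ⬝ᵥ v) := by
  simp [mulVec, dotProduct, vecMulVec_apply, Finset.mul_sum, mul_assoc]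

theorem vecMulVec_mul_vecMulVec_eq_zero {B : Type*} [Ring B] (a r b r' : ι → B)
    (h : r ⬝ᵥ b = 0) : vecMulVec a r * vecMulVec b r' = 0 := by
  ext i j
  simp only [Matrix.mul_apply, vecMulVec_apply, Matrix.zero_apply]
  have : ∀ x, a i * r x * (b x * r' j) = a i * (r x * b x) * r' j := fun x => by
    simp only [mul_assoc]
  simp only [this, ← Finset.sum_mul, ← Finset.mul_sum]
  change a i * (r ⬝ᵥ b) * r' j = 0
  rw [h]
  simp

/-- The orbit relation of invertible matrices on columns. -/
def ColumnEquiv {B : Type*} [Ring B] (v w : ι → B) : Prop :=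
  ∃ g : (Matrix ι ι B)ˣ, g.val *ᵥ v = w

theorem ColumnEquiv.trans {B : Type*} [Ring B] {u v w : ι → B} (h : ColumnEquiv u v)
    (h' : ColumnEquiv v w) : ColumnEquiv u w := by
  obtain ⟨g, rfl⟩ := h
  obtain ⟨g', rfl⟩ := h'
  exact ⟨g' * g, by rw [Units.val_mul, mulVec_mulVec]⟩

theorem columnEquiv_add_vecMulVec {B : Type*} [Ring B] {a r v : ι → B} (h : r ⬝ᵥ a = 0) :
    ColumnEquiv v fun i => v i + a i * (r ⬝ᵥ v) := by
  refine ⟨unitOfSqZero (vecMulVec_mul_vecMulVec_eq_zero a r a r h), ?_⟩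
  ext i
  simp [unitOfSqZero, add_mulVec, vecMulVec_mulVec_apply]

theorem columnEquiv_single_of_corner {B : Type*} [Ring B] {q s s' : B} (hq : q * q = q)
    (hss : s' * s = q) (hqs : q * s = 0) (hsq' : s' * q = 0) (hsq : s * q = s) {i₁ i₂ : ι}
    (hi : i₂ ≠ i₁) {r j : ι → B}
    (h : (r ⬝ᵥ fun i => (Pi.single i₁ 1 : ι → B) i + q * j i * q) = 1) :
    ColumnEquiv (fun i => (Pi.single i₁ 1 : ι → B) i + q * j i * q) (Pi.single i₁ 1) := by
  set v : ι → B := fun i => (Pi.single i₁ 1 : ι → B) i + q * j i * q with hv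
  have hqv : ∀ i, q * v i = v i * q := fun i => by
    simp only [hv, mul_add, add_mul]
    congr 1
    · rcases eq_or_ne i i₁ with rfl | hne <;> simp [*]
    · rw [mul_assoc (q * j i), hq, ← mul_assoc, ← mul_assoc, hq]
  let w : ι → B := fun i => s * (q * r i * q)
  have hwv : w ⬝ᵥ v = s := by
    have : ∀ i, w i * v i = s * (q * (r i * v i) * q) := fun i => by
      simp only [w, mul_assoc]
      rw [hqv]
    simp only [dotProduct] at h ⊢
    simp only [this, ← Finset.mul_sum, ← Finset.sum_mul, h, mul_one, hq, hsq]
  have step1 : ColumnEquiv v fun i => v i + (Pi.single i₂ 1 : ι → B) i * s := by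
    have hwn : (vecMulVec (Pi.single i₂ 1 : ι → B) w) * vecMulVec (Pi.single i₂ 1) w = 0 := by
      ext a b
      simp only [Matrix.mul_apply, vecMulVec_apply, Matrix.zero_apply]
      refine Finset.sum_eq_zero fun x _ => ?_
      rcases eq_or_ne x i₂ with rfl | hx
      · have : w x * w b = 0 := by
          simp only [w, mul_assoc]
          rw [← mul_assoc q s, hqs]
          simp
        simp [mul_assoc, this]
      · simp [hx]
    refine ⟨unitOfSqZero hwn, ?_⟩
    ext i
    simp [unitOfSqZero, add_mulVec, vecMulVec_mulVec_apply, hwv]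
  let v₁ : ι → B := fun i => v i + (Pi.single i₂ 1 : ι → B) i * s
  have hv₁ : s' * v₁ i₂ = q := by
    simp only [v₁, hv, Pi.single_eq_same, one_mul, mul_add, hss, ← mul_assoc, hsq']
    simp [hi]
  have step2 := columnEquiv_add_vecMulVec (a := Pi.single i₁ (-(q * j i₁ * q)))
    (r := Pi.single i₂ s') (v := v₁) (by simp [hi])
  let v₂ : ι → B := fun i => v₁ i + (Pi.single i₁ (-(q * j i₁ * q)) : ι → B) i *
    ((Pi.single i₂ s' : ι → B) ⬝ᵥ v₁)
  have hv₂ : v₂ i₁ = 1 := by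
    have : (Pi.single i₂ s' : ι → B) ⬝ᵥ v₁ = q := by rw [single_dotProduct, hv₁]
    simp only [v₂, this]
    simp [v₁, hi.symm, hv, mul_assoc, hq]
  have step3 := columnEquiv_add_vecMulVec (a := Pi.single i₁ 1 - v₂) (r := Pi.single i₁ 1)
    (v := v₂) (by simp [hv₂])
  refine step1.trans (step2.trans ?_)
  change ColumnEquiv v₂ _
  convert step3 using 1
  ext i
  simp [hv₂]

/-- Compatible corner projections `s N * t N` in a normed ring. -/
structure CornerSystem (B : Type*) [NormedRing B] where
  s : ℕ → B
  t : ℕ → B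
  t_mul_s : ∀ N, t N * s N = 1
  norm_le : ∀ N, ‖s N * t N‖ ≤ 1
  mul_of_le : ∀ {N M}, N ≤ M → s N * t N * (s M * t M) = s M * t M
  mul_of_le' : ∀ {N M}, N ≤ M → s M * t M * (s N * t N) = s M * t M
  tendsto : ∀ b N, Tendsto (fun M => s M * t M * b * (1 - s N * t N)) atTop (𝓝 0)

namespace CornerSystem

variable {B : Type*} [NormedRing B] (X : CornerSystem B)

/-- The corner projection. -/
def p (N : ℕ) : B := X.s N * X.t N

theorem p_mul_s (N : ℕ) : X.p N * X.s N = X.s N := by rw [p, mul_assoc, t_mul_s, mul_one]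

theorem t_mul_p (N : ℕ) : X.t N * X.p N = X.t N := by rw [p, ← mul_assoc, t_mul_s, one_mul]

theorem p_mul_p (N : ℕ) : X.p N * X.p N = X.p N := X.mul_of_le le_rfl

/-- The left ideal of elements that are asymptotically supported away from the corners. -/
def ideal : Ideal B where
  carrier := {b | Tendsto (fun N => b * X.p N) atTop (𝓝 0) ∧
    Tendsto (fun N => X.p N * b) atTop (𝓝 0)}
  zero_mem' := by simp
  add_mem' := fun {a b} ha hb => by
    constructor
    · simpa [add_mul] using ha.1.add hb.1
    · simpa [mul_add] using ha.2.add hb.2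
  smul_mem' := fun b j hj => by
    constructor
    · simpa [mul_assoc] using hj.1.const_mul b
    · rw [Metric.tendsto_nhds]
      intro ε hε
      have h1 : ∀ᶠ N in atTop, ‖b‖ * ‖X.p N * j‖ < ε / 2 := by
        have := (hj.2.norm.const_mul ‖b‖)
        rw [norm_zero, mul_zero] at this
        exact this.eventually_lt_const (half_pos hε)
      obtain ⟨N, hN⟩ := h1.exists
      have h2 : ∀ᶠ M in atTop, ‖X.p M * b * (1 - X.p N)‖ * ‖j‖ < ε / 2 := by
        have := ((X.tendsto b N).norm.mul_const ‖j‖)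
        rw [norm_zero, zero_mul] at this
        exact this.eventually_lt_const (half_pos hε)
      filter_upwards [h2] with M hM
      rw [dist_zero_right, smul_eq_mul]
      have heq : X.p M * (b * j) = X.p M * b * (1 - X.p N) * j + X.p M * (b * (X.p N * j)) := by
        simp only [mul_sub, sub_mul, mul_one, mul_assoc]
        abel
      rw [heq]
      calc _ ≤ ‖X.p M * b * (1 - X.p N)‖ * ‖j‖ + 1 * (‖b‖ * ‖X.p N * j‖) :=
            (norm_add_le _ _).trans (add_le_add (norm_mul_le _ _) ((norm_mul_le _ _).trans
              (mul_le_mul (X.norm_le M) (norm_mul_le _ _) (norm_nonneg _) zero_le_one)))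
        _ < ε := by linarith

theorem mem_ideal {b : B} : b ∈ X.ideal ↔ Tendsto (fun N => b * X.p N) atTop (𝓝 0) ∧
    Tendsto (fun N => X.p N * b) atTop (𝓝 0) := Iff.rfl

theorem one_sub_p_mem (N : ℕ) : 1 - X.p N ∈ X.ideal := by
  constructor
  · refine tendsto_const_nhds.congr' ?_
    filter_upwards [eventually_ge_atTop N] with M hM
    rw [sub_mul, one_mul, p, p, X.mul_of_le hM, sub_self]
  · refine tendsto_const_nhds.congr' ?_
    filter_upwards [eventually_ge_atTop N] with M hM
    rw [mul_sub, mul_one, p, p, X.mul_of_le' hM, sub_self]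

variable [CompleteSpace B]

theorem columnEquiv_single {i₁ i₂ : ι} (hi : i₂ ≠ i₁) {r v : ι → B} (h : r ⬝ᵥ v = 1)
    (hv : ∀ i, v i - (Pi.single i₁ 1 : ι → B) i ∈ X.ideal) :
    ColumnEquiv v (Pi.single i₁ 1) := by
  set j : ι → B := fun i => v i - (Pi.single i₁ 1 : ι → B) i with hj
  let v' : ℕ → ι → B := fun N i =>
    (Pi.single i₁ 1 : ι → B) i + (1 - X.p N) * j i * (1 - X.p N)
  have hlim : ∀ i, Tendsto (fun N => v' N i - v i) atTop (𝓝 0) := by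
    intro i
    have h1 := (X.mem_ideal.1 (hv i)).1
    have h2 := (X.mem_ideal.1 (hv i)).2
    rw [tendsto_zero_iff_norm_tendsto_zero] at h1 h2 ⊢
    refine squeeze_zero (fun _ => norm_nonneg _) (fun N => ?_)
      ((h1.add (h2.add h2)).trans (by simp))
    have heq : v' N i - v i = -(j i * X.p N) - (X.p N * j i - X.p N * j i * X.p N) := by
      simp only [v', hj]
      noncomm_ring
    rw [heq]
    refine (norm_sub_le _ _).trans (add_le_add (norm_neg _).le ((norm_sub_le _ _).trans
      (add_le_add le_rfl ((norm_mul_le _ _).trans ?_))))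
    exact mul_le_of_le_one_right (norm_nonneg _) (X.norm_le N)
  have hmat : Tendsto (fun N => 1 + vecMulVec (v' N - v) r) atTop (𝓝 (1 : Matrix ι ι B)) := by
    have : Tendsto (fun N => vecMulVec (v' N - v) r) atTop (𝓝 (0 : Matrix ι ι B)) := by
      refine tendsto_pi_nhds.2 fun a => tendsto_pi_nhds.2 fun b => ?_
      simpa [vecMulVec_apply] using (hlim a).mul_const (r b)
    simpa using this.const_add 1
  obtain ⟨N, g, hg⟩ := (hmat.eventually (eventually_isUnit_matrix isUnit_one)).exists
  have hgv : g.val *ᵥ v = v' N := by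
    ext i
    rw [hg]
    simp [add_mulVec, vecMulVec_mulVec_apply, h]
  refine ColumnEquiv.trans ⟨g, hgv⟩ ?_
  have hpp := X.p_mul_p N
  have hqq : (1 - X.p N) * (1 - X.p N) = 1 - X.p N := by
    simp [mul_sub, sub_mul, hpp]
  refine columnEquiv_single_of_corner (q := 1 - X.p N) (s := X.s N * (1 - X.p N))
    (s' := (1 - X.p N) * X.t N) hqq ?_ ?_ ?_ ?_ hi (r := r ᵥ* g⁻¹.val) ?_
  · rw [mul_assoc, ← mul_assoc (X.t N), X.t_mul_s, one_mul, hqq]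
  · rw [← mul_assoc, sub_mul, X.p_mul_s, one_mul, sub_self, zero_mul]
  · rw [mul_assoc, mul_sub, X.t_mul_p, mul_one, sub_self, mul_zero]
  · rw [mul_assoc, hqq]
  · change (r ᵥ* g⁻¹.val) ⬝ᵥ v' N = 1
    rw [← hgv, dotProduct_mulVec, vecMul_vecMul, g.inv_mul, vecMul_one, h]

end CornerSystem

end Corner

section ToeplitzCorner

open Matrix Filter Topology

/-- The elements `b` for which `p M * b * (1 - p N)` tends to zero as `M → ∞`, for all `N`. -/
def cornerSubalgebra {E : Type*} [NormedRing E] [NormedAlgebra ℂ E] (p : ℕ → E)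
    (hp : ∀ N, ‖p N‖ ≤ 1) (hpp : ∀ {N M}, N ≤ M → p M * p N = p M) : Subalgebra ℂ E where
  carrier := {b | ∀ N, Tendsto (fun M => p M * b * (1 - p N)) atTop (𝓝 0)}
  algebraMap_mem' := fun c N => by
    refine tendsto_const_nhds.congr' ?_
    filter_upwards [eventually_ge_atTop N] with M hM
    rw [← Algebra.commutes, mul_assoc, mul_sub, mul_one, hpp hM, sub_self, mul_zero]
  add_mem' := fun {a b} ha hb N => by
    simpa [mul_add, add_mul] using (ha N).add (hb N)
  mul_mem' := fun {a b} ha hb N => by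
    rw [Metric.tendsto_nhds]
    intro ε hε
    have h1 : ∀ᶠ L in atTop, ‖a‖ * ‖p L * b * (1 - p N)‖ < ε / 2 := by
      have := ((hb N).norm.const_mul ‖a‖)
      rw [norm_zero, mul_zero] at this
      exact this.eventually_lt_const (half_pos hε)
    obtain ⟨L, hL⟩ := h1.exists
    have h2 : ∀ᶠ M in atTop, ‖p M * a * (1 - p L)‖ * ‖b * (1 - p N)‖ < ε / 2 := by
      have := ((ha L).norm.mul_const ‖b * (1 - p N)‖)
      rw [norm_zero, zero_mul] at this
      exact this.eventually_lt_const (half_pos hε)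
    filter_upwards [h2] with M hM
    rw [dist_zero_right]
    have heq : p M * (a * b) * (1 - p N) = p M * a * (1 - p L) * (b * (1 - p N)) +
        p M * (a * (p L * b * (1 - p N))) := by
      noncomm_ring
    rw [heq]
    calc _ ≤ ‖p M * a * (1 - p L)‖ * ‖b * (1 - p N)‖ + 1 * (‖a‖ * ‖p L * b * (1 - p N)‖) :=
          (norm_add_le _ _).trans (add_le_add (norm_mul_le _ _) ((norm_mul_le _ _).trans
            (mul_le_mul (hp M) (norm_mul_le _ _) (norm_nonneg _) zero_le_one)))
      _ < ε := by linarith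

theorem isClosed_cornerSubalgebra {E : Type*} [NormedRing E] [NormedAlgebra ℂ E] (p : ℕ → E)
    (hp : ∀ N, ‖p N‖ ≤ 1) (hpp : ∀ {N M}, N ≤ M → p M * p N = p M) :
    IsClosed (cornerSubalgebra p hp hpp : Set E) := by
  refine isClosed_of_closure_subset fun b hb N => ?_
  rw [Metric.tendsto_nhds]
  intro ε hε
  have hC : 0 < ‖1 - p N‖ + 1 := by positivity
  obtain ⟨b', hb', hd⟩ := Metric.mem_closure_iff.1 hb (ε / 2 / (‖1 - p N‖ + 1)) (by positivity)
  filter_upwards [(Metric.tendsto_nhds.1 (hb' N)) (ε / 2) (half_pos hε)] with M hM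
  rw [dist_zero_right] at hM ⊢
  rw [dist_eq_norm, lt_div_iff₀ hC] at hd
  have heq : p M * b * (1 - p N) = p M * b' * (1 - p N) + p M * ((b - b') * (1 - p N)) := by
    noncomm_ring
  rw [heq]
  have h3 : ‖p M * ((b - b') * (1 - p N))‖ ≤ 1 * (‖b - b'‖ * ‖1 - p N‖) :=
    (norm_mul_le _ _).trans (mul_le_mul (hp M) (norm_mul_le _ _) (norm_nonneg _) zero_le_one)
  have := norm_nonneg (b - b')
  refine (norm_add_le _ _).trans_lt ?_
  nlinarith

variable {n : ℕ}

/-- The constant multi-index. -/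
def constIndex (n N : ℕ) : Fin n → ℕ := fun _ => N

theorem shift_diag_of_le {N M : ℕ} (h : N ≤ M) :
    shift (constIndex n M) = shift (constIndex n N) * shift (constIndex n (M - N)) := by
  rw [← shift_add]
  congr 1
  ext i
  simp [constIndex]
  omega

/-- The range projection of the diagonal shift. -/
def diagProj (n N : ℕ) : Hn n →L[ℂ] Hn n := shift (constIndex n N) * star (shift (constIndex n N))

theorem star_diagProj (N : ℕ) : star (diagProj n N) = diagProj n N := by
  simp [diagProj]

theorem norm_diagProj_le (N : ℕ) : ‖diagProj n N‖ ≤ 1 :=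
  (norm_mul_le _ _).trans (mul_le_one₀ (norm_shift_le _) (norm_nonneg _) (norm_star_shift_le _))

theorem diagProj_mul_shift (N : ℕ) :
    diagProj n N * shift (constIndex n N) = shift (constIndex n N) := by
  rw [diagProj, mul_assoc, star_shift_mul_shift, mul_one]

theorem diagProj_mul_of_le {N M : ℕ} (h : N ≤ M) : diagProj n N * diagProj n M = diagProj n M := by
  conv_lhs => rw [diagProj.eq_1 n M]
  rw [← mul_assoc, shift_diag_of_le h, ← mul_assoc, diagProj_mul_shift, ← shift_diag_of_le h]
  rfl

theorem diagProj_mul_of_le' {N M : ℕ} (h : N ≤ M) :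
    diagProj n M * diagProj n N = diagProj n M := by
  have := congrArg star (diagProj_mul_of_le (n := n) h)
  simpa [star_diagProj] using this

theorem diagProj_mul_shift_mul (N : ℕ) (i : Fin n) : diagProj n N * shift (Pi.single i 1) *
    diagProj n N = shift (Pi.single i 1) * diagProj n N := by
  have : shift (Pi.single i 1) * diagProj n N =
      shift (constIndex n N) * (shift (Pi.single i 1) * star (shift (constIndex n N))) := by
    rw [diagProj, ← mul_assoc, ← mul_assoc, (commute_shift _ _).eq]
  rw [mul_assoc, this, ← mul_assoc, diagProj_mul_shift]

theorem diagProj_mul_star_shift_mul {N M : ℕ} (h : N < M) (i : Fin n) :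
    (1 - diagProj n N) * star (shift (Pi.single i 1)) * diagProj n M = 0 := by
  have h1 : shift (constIndex n M) = shift (Pi.single i 1) * (shift (constIndex n N) *
      shift (fun j => M - N - (Pi.single i 1 : Fin n → ℕ) j)) := by
    rw [← shift_add, ← shift_add]
    congr 1
    ext j
    simp only [Pi.add_apply, constIndex]
    rcases eq_or_ne j i with rfl | hj
    · simp
      omega
    · simp [hj]
      omega
  have h2 : star (shift (Pi.single i 1)) * shift (constIndex n M) = shift (constIndex n N) *
      shift (fun j => M - N - (Pi.single i 1 : Fin n → ℕ) j) := by
    rw [h1, ← mul_assoc, star_shift_mul_shift, one_mul]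
  rw [diagProj.eq_1 n M, ← mul_assoc, mul_assoc (1 - _) (star _), h2, ← mul_assoc, sub_mul, one_mul,
    diagProj_mul_shift, sub_self, zero_mul, zero_mul]

theorem toeplitz_le_cornerSubalgebra : (Toeplitz n).toSubalgebra ≤
    cornerSubalgebra (diagProj n) norm_diagProj_le diagProj_mul_of_le' := by
  intro x hx
  have hx' : x ∈ closure (StarAlgebra.adjoin ℂ
    {T : Hn n →L[ℂ] Hn n | ∃ i : Fin n, IsShift i T} : Set (Hn n →L[ℂ] Hn n)) := hx
  refine closure_minimal ?_ (isClosed_cornerSubalgebra _ _ _) hx'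
  change (StarAlgebra.adjoin ℂ {T : Hn n →L[ℂ] Hn n | ∃ i : Fin n, IsShift i T}).toSubalgebra ≤ _
  rw [StarAlgebra.adjoin_toSubalgebra, Algebra.adjoin_le_iff]
  rintro T (⟨i, hi⟩ | ⟨i, hi⟩) N
  · obtain rfl := isShift_iff.1 hi
    refine tendsto_const_nhds.congr' ?_
    filter_upwards [eventually_gt_atTop N] with M hM
    have := congrArg star (diagProj_mul_star_shift_mul hM i)
    simpa [star_diagProj, mul_assoc] using this.symm
  · have hT : star T = _ := isShift_iff.1 hi
    obtain rfl : T = star (shift (Pi.single i 1)) := by rw [← hT, star_star]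
    refine tendsto_const_nhds.congr' ?_
    filter_upwards [eventually_ge_atTop N] with M hM
    have h1 := congrArg star (diagProj_mul_shift_mul N i)
    simp only [star_mul, star_diagProj] at h1
    have : diagProj n N * star (shift (Pi.single i 1)) * (1 - diagProj n N) = 0 := by
      rw [mul_sub, mul_one, mul_assoc, h1, sub_self]
    rw [← diagProj_mul_of_le' hM, mul_assoc, mul_assoc, ← mul_assoc (diagProj n N), this, mul_zero]

/-- The corner system of the Toeplitz algebra given by the diagonal shifts. -/
def toeplitzCorner (n : ℕ) : CornerSystem (Toeplitz n) where
  s N := ⟨shift (constIndex n N), shift_mem_toeplitz _⟩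
  t N := ⟨star (shift (constIndex n N)), star_mem (shift_mem_toeplitz _)⟩
  t_mul_s N := Subtype.ext (star_shift_mul_shift _)
  norm_le N := norm_diagProj_le (n := n) N
  mul_of_le h := Subtype.ext (diagProj_mul_of_le h)
  mul_of_le' h := Subtype.ext (diagProj_mul_of_le' h)
  tendsto b N := tendsto_subtype_rng.2 (toeplitz_le_cornerSubalgebra b.2 N)

end ToeplitzCorner

section TorusHilbert

open Matrix Filter Topology

open MeasureTheory

local instance : MeasureSpace UnitAddCircle := ⟨AddCircle.haarAddCircle⟩

local instance : Measure.IsAddHaarMeasure (volume : Measure UnitAddCircle) :=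
  inferInstanceAs (Measure.IsAddHaarMeasure AddCircle.haarAddCircle)

local instance : IsProbabilityMeasure (volume : Measure UnitAddCircle) :=
  inferInstanceAs (IsProbabilityMeasure AddCircle.haarAddCircle)

/-- The square-integrable functions on the torus, with the properties that are needed below. -/
theorem exists_hilbert_torus (n : ℕ) : ∃ (E : Type) (_ : NormedAddCommGroup E)
    (_ : InnerProductSpace ℂ E) (_ : CompleteSpace E)
    (τ : C(UnitAddTorus (Fin n), ℂ) →L[ℂ] E), Function.Injective τ ∧
      Orthonormal ℂ (fun z => τ (UnitAddTorus.mFourier z)) ∧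
      ∀ (f g : C(UnitAddTorus (Fin n), ℂ)) (c : ℝ), (∀ x, ‖f x‖ ≤ c * ‖g x‖) →
        ‖τ f‖ ≤ c * ‖τ g‖ := by
  refine ⟨Lp ℂ 2 (volume : Measure (UnitAddTorus (Fin n))), inferInstance, inferInstance,
    inferInstance, ContinuousMap.toLp (E := ℂ) 2 volume ℂ, ContinuousMap.toLp_injective _,
    UnitAddTorus.orthonormal_mFourier, fun f g c h => ?_⟩
  refine Lp.norm_le_mul_norm_of_ae_le_mul ?_
  filter_upwards [ContinuousMap.coeFn_toLp (p := 2) (𝕜 := ℂ) volume f,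
    ContinuousMap.coeFn_toLp (p := 2) (𝕜 := ℂ) volume g] with x hf hg
  rw [hf, hg]
  exact h x

end TorusHilbert

section Symbols

open Matrix Filter Topology

open UnitAddTorus

variable {n : ℕ}

/-- The monomial with nonnegative exponents. -/
def monomialTorus (a : Fin n → ℕ) : C(UnitAddTorus (Fin n), ℂ) := mFourier fun i => (a i : ℤ)

theorem norm_mFourier_apply (c : Fin n → ℤ) (x : UnitAddTorus (Fin n)) : ‖mFourier c x‖ = 1 := by
  simp only [mFourier, ContinuousMap.coe_mk, norm_prod, fourier_apply, Circle.norm_coe,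
    Finset.prod_const_one]

theorem mFourier_add' (c d : Fin n → ℤ) : mFourier (c + d) = mFourier c * mFourier d := by
  ext x
  exact mFourier_add

theorem star_mFourier (c : Fin n → ℤ) : star (mFourier c) = mFourier (-c) := by
  ext x
  exact mFourier_neg.symm

variable {E : Type*} [NormedAddCommGroup E] [InnerProductSpace ℂ E]
  (W : Hn n →ₗᵢ[ℂ] E) (τ : C(UnitAddTorus (Fin n), ℂ) →L[ℂ] E)

/-- The operator `x` acts far away from the walls as multiplication by `f`. -/
def HasSymbol (x : Hn n →L[ℂ] Hn n) (f : C(UnitAddTorus (Fin n), ℂ)) : Prop :=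
  ∃ N₀ : ℕ, ∀ a : Fin n → ℕ, (∀ i, N₀ ≤ a i) → W (x (delta a)) = τ (f * monomialTorus a)

variable {W τ}

theorem HasSymbol.add {x y : Hn n →L[ℂ] Hn n} {f g : C(UnitAddTorus (Fin n), ℂ)}
    (hx : HasSymbol W τ x f) (hy : HasSymbol W τ y g) : HasSymbol W τ (x + y) (f + g) := by
  obtain ⟨N, hN⟩ := hx
  obtain ⟨M, hM⟩ := hy
  refine ⟨max N M, fun a ha => ?_⟩
  rw [_root_.add_apply, map_add, hN a fun i => (le_max_left _ _).trans (ha i),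
    hM a fun i => (le_max_right _ _).trans (ha i), add_mul, map_add]

theorem HasSymbol.smul {x : Hn n →L[ℂ] Hn n} {f : C(UnitAddTorus (Fin n), ℂ)} (c : ℂ)
    (hx : HasSymbol W τ x f) : HasSymbol W τ (c • x) (c • f) := by
  obtain ⟨N, hN⟩ := hx
  refine ⟨N, fun a ha => ?_⟩
  rw [_root_.smul_apply, map_smul, hN a ha, smul_mul_assoc, map_smul]

theorem HasSymbol.zero : HasSymbol W τ 0 0 := ⟨0, fun a _ => by simp⟩

theorem HasSymbol.norm_mul_shift_le
    (hW : ∀ a, W (delta a) = τ (monomialTorus a))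
    (hτ : ∀ (f g : C(UnitAddTorus (Fin n), ℂ)) (c : ℝ), (∀ x, ‖f x‖ ≤ c * ‖g x‖) →
        ‖τ f‖ ≤ c * ‖τ g‖) {x : Hn n →L[ℂ] Hn n} {f : C(UnitAddTorus (Fin n), ℂ)}
    (hx : HasSymbol W τ x f) : ∀ᶠ N in atTop, ‖x * shift (constIndex n N)‖ ≤ ‖f‖ := by
  obtain ⟨N₀, hN₀⟩ := hx
  filter_upwards [eventually_ge_atTop N₀] with N hN
  refine ContinuousLinearMap.opNorm_le_bound _ (norm_nonneg _) fun h => ?_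
  have hsum : Tendsto (fun F : Finset (Fin n → ℕ) => ∑ z ∈ F, h z • delta z) atTop (𝓝 h) := by
    have := lp.hasSum_single (p := 2) (by simp) h
    refine this.congr fun F => Finset.sum_congr rfl fun z _ => ?_
    rw [delta, ← lp.single_smul, smul_eq_mul, mul_one]
  refine le_of_tendsto_of_tendsto
    (((x * shift (constIndex n N)).continuous.tendsto h).comp hsum).norm
    (hsum.norm.const_mul _) (Eventually.of_forall fun F => ?_)
  simp only [Function.comp_apply]
  set g : C(UnitAddTorus (Fin n), ℂ) := ∑ z ∈ F, h z • monomialTorus (z + constIndex n N) with hg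
  have h1 : W ((x * shift (constIndex n N)) (∑ z ∈ F, h z • delta z)) = τ (f * g) := by
    simp only [hg, Finset.mul_sum, map_sum, map_smul, mul_smul_comm]
    refine Finset.sum_congr rfl fun z _ => ?_
    rw [mul_apply_eq_comp, shift_delta, hN₀]
    exact fun i => hN.trans (by simp [constIndex])
  have h2 : W (shift (constIndex n N) (∑ z ∈ F, h z • delta z)) = τ g := by
    simp only [hg, map_sum, map_smul]
    exact Finset.sum_congr rfl fun z _ => by rw [shift_delta, hW]
  rw [← W.norm_map, h1, ← norm_shift_apply (constIndex n N), ← W.norm_map (shift _ _), h2]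
  exact hτ _ _ _ fun t => by
    rw [ContinuousMap.mul_apply, norm_mul]
    exact mul_le_mul_of_nonneg_right (f.norm_coe_le_norm t) (norm_nonneg _)

theorem HasSymbol.norm_le_sum {ι : Type*} [Fintype ι] {r x : ι → Hn n →L[ℂ] Hn n}
    {f : ι → C(UnitAddTorus (Fin n), ℂ)}
    (hW : ∀ a, W (delta a) = τ (monomialTorus a))
    (hτ : ∀ (f g : C(UnitAddTorus (Fin n), ℂ)) (c : ℝ), (∀ x, ‖f x‖ ≤ c * ‖g x‖) →
        ‖τ f‖ ≤ c * ‖τ g‖) (hx : ∀ i, HasSymbol W τ (x i) (f i)) (h : ∑ i, r i * x i = 1)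
    (g : C(UnitAddTorus (Fin n), ℂ)) : ‖τ g‖ ≤ ∑ i, ‖r i‖ * ‖τ (f i * g)‖ := by
  choose N hN using hx
  have key : ∀ p ∈ Submodule.span ℂ (Set.range (mFourier (d := Fin n))), ∃ K₀ : ℕ, ∀ K ≥ K₀,
      ∃ h : Hn n, W h = τ (monomialTorus (constIndex n K) * p) ∧
        ∀ i, W (x i h) = τ (f i * (monomialTorus (constIndex n K) * p)) := by
    intro p hp
    induction hp using Submodule.span_induction with
    | mem p hp =>
      obtain ⟨c, rfl⟩ := hp
      refine ⟨∑ i, N i + ∑ i, (c i).natAbs, fun K hK => ?_⟩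
      have hcK : ∀ i, (c i).natAbs ≤ ∑ i, (c i).natAbs := fun i =>
        Finset.single_le_sum (f := fun i => (c i).natAbs) (fun _ _ => Nat.zero_le _)
          (Finset.mem_univ i)
      have hNK : ∀ i, N i ≤ ∑ i, N i := fun i =>
        Finset.single_le_sum (f := fun i => N i) (fun _ _ => Nat.zero_le _) (Finset.mem_univ i)
      have hmon : monomialTorus (fun i => ((K : ℤ) + c i).toNat) =
          monomialTorus (constIndex n K) * mFourier c := by
        rw [monomialTorus, monomialTorus, ← mFourier_add']
        congr 1
        ext i
        have := hcK i
        simp only [Pi.add_apply, constIndex]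
        omega
      refine ⟨delta fun i => ((K : ℤ) + c i).toNat, ?_, fun i => ?_⟩
      · rw [hW, hmon]
      · rw [hN, hmon]
        intro j
        have := hcK j
        have := hNK i
        omega
    | zero => exact ⟨0, fun K _ => ⟨0, by simp, by simp⟩⟩
    | add p q _ _ ihp ihq =>
      obtain ⟨K₁, h₁⟩ := ihp
      obtain ⟨K₂, h₂⟩ := ihq
      refine ⟨max K₁ K₂, fun K hK => ?_⟩
      obtain ⟨a, ha, ha'⟩ := h₁ K ((le_max_left _ _).trans hK)
      obtain ⟨b, hb, hb'⟩ := h₂ K ((le_max_right _ _).trans hK)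
      exact ⟨a + b, by rw [map_add, ha, hb, mul_add, map_add], fun i => by
        rw [map_add, map_add, ha', hb', mul_add, mul_add, map_add]⟩
    | smul c p _ ihp =>
      obtain ⟨K₁, h₁⟩ := ihp
      refine ⟨K₁, fun K hK => ?_⟩
      obtain ⟨a, ha, ha'⟩ := h₁ K hK
      exact ⟨c • a, by rw [map_smul, ha, mul_smul_comm, map_smul], fun i => by
        rw [map_smul, map_smul, ha', mul_smul_comm, mul_smul_comm, map_smul]⟩
  have hclosed : IsClosed {g : C(UnitAddTorus (Fin n), ℂ) | ‖τ g‖ ≤ ∑ i, ‖r i‖ * ‖τ (f i * g)‖} :=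
    isClosed_le (by fun_prop) (by fun_prop)
  have hdense : g ∈ closure (Submodule.span ℂ (Set.range (mFourier (d := Fin n))) : Set _) := by
    rw [← Submodule.topologicalClosure_coe, span_mFourier_closure_eq_top]
    trivial
  refine closure_minimal ?_ hclosed hdense
  intro p hp
  obtain ⟨K, hK⟩ := key p hp
  obtain ⟨a, ha, ha'⟩ := hK K le_rfl
  have hn : ∀ y : UnitAddTorus (Fin n), ‖monomialTorus (constIndex n K) y‖ = 1 :=
    norm_mFourier_apply _
  have hpa : ‖τ p‖ ≤ ‖a‖ := by
    rw [← W.norm_map, ha]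
    simpa using hτ p (monomialTorus (constIndex n K) * p) 1 fun y => by simp [hn]
  have hax : ∀ i, ‖x i a‖ ≤ ‖τ (f i * p)‖ := fun i => by
    rw [← W.norm_map, ha']
    simpa using hτ (f i * (monomialTorus (constIndex n K) * p)) (f i * p) 1 fun y => by simp [hn]
  have haa : a = ∑ i, r i (x i a) := by
    have := congrArg (fun T : Hn n →L[ℂ] Hn n => T a) h
    simpa [_root_.sum_apply] using this.symm
  calc ‖τ p‖ ≤ ‖a‖ := hpa
    _ = ‖∑ i, r i (x i a)‖ := by rw [← haa]
    _ ≤ ∑ i, ‖r i‖ * ‖τ (f i * p)‖ := norm_sum_le_of_le _ fun i _ =>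
      ((r i).le_opNorm _).trans (mul_le_mul_of_nonneg_left (hax i) (norm_nonneg _))

theorem HasSymbol.exists_ne_zero {ι : Type*} [Fintype ι] {r x : ι → Hn n →L[ℂ] Hn n}
    {f : ι → C(UnitAddTorus (Fin n), ℂ)}
    (hW : ∀ a, W (delta a) = τ (monomialTorus a)) (hinj : Function.Injective τ)
    (hτ : ∀ (f g : C(UnitAddTorus (Fin n), ℂ)) (c : ℝ), (∀ x, ‖f x‖ ≤ c * ‖g x‖) →
        ‖τ f‖ ≤ c * ‖τ g‖) (hx : ∀ i, HasSymbol W τ (x i) (f i)) (h : ∑ i, r i * x i = 1)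
    (θ : UnitAddTorus (Fin n)) : ∃ i, f i θ ≠ 0 := by
  by_contra! hθ
  have hR : 0 ≤ ∑ i, ‖r i‖ := Finset.sum_nonneg fun _ _ => norm_nonneg _
  set δ : ℝ := (∑ i, ‖r i‖ + 1)⁻¹ with hδ
  have hδ0 : 0 < δ := by positivity
  have hδ1 : (∑ i, ‖r i‖) * δ < 1 := by
    rw [hδ, ← div_eq_mul_inv, div_lt_one (by positivity)]
    linarith
  let g : C(UnitAddTorus (Fin n), ℂ) :=
    ⟨fun y => ((max 0 (δ - ∑ i, ‖f i y‖) : ℝ) : ℂ), by fun_prop⟩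
  have hfg : ∀ i, ‖τ (f i * g)‖ ≤ δ * ‖τ g‖ := fun i => hτ _ _ _ fun y => by
    rw [ContinuousMap.mul_apply, norm_mul]
    rcases le_total (δ - ∑ i, ‖f i y‖) 0 with h0 | h0
    · simp [g, max_eq_left h0]
    · refine mul_le_mul_of_nonneg_right ?_ (norm_nonneg _)
      have := Finset.single_le_sum (f := fun i => ‖f i y‖) (fun _ _ => norm_nonneg _)
        (Finset.mem_univ i)
      linarith
  have h1 := HasSymbol.norm_le_sum hW hτ hx h g
  have h2 : ‖τ g‖ ≤ (∑ i, ‖r i‖) * δ * ‖τ g‖ := by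
    refine h1.trans ?_
    rw [mul_assoc, Finset.sum_mul]
    exact Finset.sum_le_sum fun i _ => mul_le_mul_of_nonneg_left (hfg i) (norm_nonneg _)
  have h3 : τ g = 0 := by
    rw [← norm_le_zero_iff]
    nlinarith [norm_nonneg (τ g)]
  have h4 : g = 0 := hinj (by rw [h3, map_zero])
  have h5 : g θ = 0 := by rw [h4]; rfl
  simp [g, hθ, max_eq_right hδ0.le, hδ0.ne'] at h5

end Symbols

section SymbolSystem

open Matrix Filter Topology

open UnitAddTorus

/-- A symbol calculus with values in functions on a torus, compatible with a corner system. -/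
structure SymbolSystem (n : ℕ) {A : Type*} [NormedRing A] [StarRing A] [NormedAlgebra ℂ A]
    [StarModule ℂ A] (X : CornerSystem A) where
  rel : StarSubalgebra ℂ (A × C(UnitAddTorus (Fin n), ℂ))
  dense : ∀ (a : A) (ε : ℝ), 0 < ε → ∃ p ∈ rel, ‖p.1 - a‖ < ε
  contDiff : ∀ p ∈ rel, ContDiff ℝ 1 fun θ : Fin n → ℝ => p.2 fun i => (θ i : UnitAddCircle)
  norm_le : ∀ p ∈ rel, ∀ᶠ N in atTop, ‖p.1 * X.p N‖ ≤ ‖p.2‖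
  exists_ne_zero : ∀ {ι : Type} [Fintype ι] (r : ι → A)
    (p : ι → A × C(UnitAddTorus (Fin n), ℂ)), (∀ i, p i ∈ rel) → ∑ i, r i * (p i).1 = 1 →
      ∀ θ, ∃ i, (p i).2 θ ≠ 0

variable {n : ℕ}

/-- Far away from the walls, `w` translates the standard basis by `c`. -/
def IsTranslation (c : Fin n → ℤ) (w : Hn n →L[ℂ] Hn n) : Prop :=
  ∃ N₀ : ℕ, ∀ a : Fin n → ℕ, (∀ i, N₀ ≤ a i) →
    ∃ b : Fin n → ℕ, (∀ i, (b i : ℤ) = a i + c i) ∧ w (delta a) = delta b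

theorem IsTranslation.one : IsTranslation (0 : Fin n → ℤ) 1 :=
  ⟨0, fun a _ => ⟨a, by simp, by simp⟩⟩

theorem IsTranslation.mul {c d : Fin n → ℤ} {w v : Hn n →L[ℂ] Hn n} (hw : IsTranslation c w)
    (hv : IsTranslation d v) : IsTranslation (c + d) (w * v) := by
  obtain ⟨N, hN⟩ := hw
  obtain ⟨M, hM⟩ := hv
  refine ⟨N + M + ∑ i, (d i).natAbs, fun a ha => ?_⟩
  obtain ⟨b, hb, hvb⟩ := hM a fun i => le_trans (by omega) (ha i)
  obtain ⟨b', hb', hwb⟩ := hN b fun i => by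
    have h1 := ha i
    have h2 := hb i
    have h3 := Finset.single_le_sum (f := fun i => (d i).natAbs) (fun _ _ => Nat.zero_le _)
      (Finset.mem_univ i)
    omega
  refine ⟨b', fun i => ?_, by rw [mul_apply_eq_comp, hvb, hwb]⟩
  rw [hb', hb, Pi.add_apply]
  ring

theorem isTranslation_shift (c : Fin n → ℕ) :
    IsTranslation (fun i => (c i : ℤ)) (shift c) :=
  ⟨0, fun a _ => ⟨a + c, by simp, by simp⟩⟩

theorem isTranslation_star_shift (c : Fin n → ℕ) :
    IsTranslation (-fun i => (c i : ℤ)) (star (shift c)) := by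
  refine ⟨∑ i, c i, fun a ha => ?_⟩
  have hca : c ≤ a := fun i => (Finset.single_le_sum (f := c) (fun _ _ => Nat.zero_le _)
      (Finset.mem_univ i)).trans (ha i)
  refine ⟨a - c, fun i => ?_, ?_⟩
  · have := Nat.cast_sub (R := ℤ) (hca i)
    simp only [Pi.sub_apply, Pi.neg_apply, this]
    ring
  · conv_lhs => rw [← tsub_add_cancel_of_le hca]
    rw [star_shift_delta_add]

theorem IsTranslation.hasSymbol {E : Type*} [NormedAddCommGroup E] [InnerProductSpace ℂ E]
    {W : Hn n →ₗᵢ[ℂ] E} {τ : C(UnitAddTorus (Fin n), ℂ) →L[ℂ] E}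
    (hW : ∀ a, W (delta a) = τ (monomialTorus a)) {c : Fin n → ℤ} {w : Hn n →L[ℂ] Hn n}
    (hw : IsTranslation c w) : HasSymbol W τ w (mFourier c) := by
  obtain ⟨N, hN⟩ := hw
  refine ⟨N, fun a ha => ?_⟩
  obtain ⟨b, hb, hwb⟩ := hN a ha
  rw [hwb, hW, monomialTorus, monomialTorus, ← mFourier_add']
  congr 2
  ext i
  simp [hb, add_comm]

/-- Pairs consisting of a translation and the associated monomial. -/
def translationPairs (n : ℕ) : Submonoid (Toeplitz n × C(UnitAddTorus (Fin n), ℂ)) where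
  carrier := {p | ∃ c, IsTranslation c p.1.val ∧ IsTranslation (-c) (star p.1.val) ∧
    p.2 = mFourier c}
  one_mem' := ⟨0, IsTranslation.one, by simpa using IsTranslation.one, mFourier_zero.symm⟩
  mul_mem' := by
    rintro p q ⟨c, hc, hc', hp⟩ ⟨d, hd, hd', hq⟩
    refine ⟨c + d, hc.mul hd, ?_, ?_⟩
    · rw [neg_add_rev]
      have : star (p * q).1.val = star q.1.val * star p.1.val := star_mul p.1.val q.1.val
      rw [this]
      exact hd'.mul hc'
    · rw [mFourier_add', ← hp, ← hq]
      rfl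

theorem star_mem_translationPairs {p : Toeplitz n × C(UnitAddTorus (Fin n), ℂ)}
    (hp : p ∈ translationPairs n) : star p ∈ translationPairs n := by
  obtain ⟨c, hc, hc', hp⟩ := hp
  refine ⟨-c, hc', ?_, ?_⟩
  · have : star (star p).1.val = p.1.val := star_star p.1.val
    rw [this, neg_neg]
    exact hc
  · rw [← star_mFourier, ← hp]
    rfl

/-- The span of a star-closed submonoid, as a star subalgebra. -/
def spanStarSubalgebra {R : Type*} [Ring R] [StarRing R] [Algebra ℂ R] [StarModule ℂ R]
    (G : Submonoid R) (h : ∀ x ∈ G, star x ∈ G) : StarSubalgebra ℂ R where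
  toSubalgebra := Algebra.adjoin ℂ (G : Set R)
  star_mem' := by
    change Algebra.adjoin ℂ (G : Set R) ≤ star (Algebra.adjoin ℂ (G : Set R))
    refine Algebra.adjoin_le fun p hp => ?_
    exact Algebra.subset_adjoin (h p hp)

theorem mem_spanStarSubalgebra {R : Type*} [Ring R] [StarRing R] [Algebra ℂ R] [StarModule ℂ R]
    {G : Submonoid R} {h : ∀ x ∈ G, star x ∈ G} {x : R} :
    x ∈ spanStarSubalgebra G h ↔ x ∈ Submodule.span ℂ (G : Set R) := by
  change x ∈ (Algebra.adjoin ℂ (G : Set R)).toSubmodule ↔ _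
  rw [Algebra.adjoin_eq_span, Submonoid.closure_eq]

/-- The algebraic symbol relation. -/
def symbolRel (n : ℕ) : StarSubalgebra ℂ (Toeplitz n × C(UnitAddTorus (Fin n), ℂ)) :=
  spanStarSubalgebra (translationPairs n) fun _ => star_mem_translationPairs

theorem mem_symbolRel {p : Toeplitz n × C(UnitAddTorus (Fin n), ℂ)} :
    p ∈ symbolRel n ↔ p ∈ Submodule.span ℂ (translationPairs n : Set
      (Toeplitz n × C(UnitAddTorus (Fin n), ℂ))) :=
  mem_spanStarSubalgebra

theorem hasSymbol_of_mem_symbolRel {E : Type*} [NormedAddCommGroup E] [InnerProductSpace ℂ E]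
    {W : Hn n →ₗᵢ[ℂ] E} {τ : C(UnitAddTorus (Fin n), ℂ) →L[ℂ] E}
    (hW : ∀ a, W (delta a) = τ (monomialTorus a))
    {p : Toeplitz n × C(UnitAddTorus (Fin n), ℂ)} (hp : p ∈ symbolRel n) :
    HasSymbol W τ p.1.val p.2 := by
  rw [mem_symbolRel] at hp
  induction hp using Submodule.span_induction with
  | mem p hp =>
    obtain ⟨c, hc, -, hp⟩ := hp
    rw [hp]
    exact hc.hasSymbol hW
  | zero => exact HasSymbol.zero
  | add p q _ _ hp hq => exact hp.add hq
  | smul c p _ hp => exact hp.smul c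

theorem contDiff_mFourier (c : Fin n → ℤ) :
    ContDiff ℝ 1 fun θ : Fin n → ℝ => mFourier c fun i => (θ i : UnitAddCircle) := by
  simp only [mFourier, ContinuousMap.coe_mk]
  refine contDiff_prod fun i _ => ?_
  simp only [fourier_coe_apply]
  have : ContDiff ℝ 1 fun θ : Fin n → ℝ => ((θ i : ℝ) : ℂ) :=
    Complex.ofRealCLM.contDiff.comp (contDiff_apply ℝ ℝ i)
  fun_prop

theorem contDiff_of_mem_symbolRel {p : Toeplitz n × C(UnitAddTorus (Fin n), ℂ)}
    (hp : p ∈ symbolRel n) :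
    ContDiff ℝ 1 fun θ : Fin n → ℝ => p.2 fun i => (θ i : UnitAddCircle) := by
  rw [mem_symbolRel] at hp
  induction hp using Submodule.span_induction with
  | mem p hp =>
    obtain ⟨c, -, -, hp⟩ := hp
    rw [hp]
    exact contDiff_mFourier c
  | zero => exact contDiff_const
  | add p q _ _ hp hq => exact hp.add hq
  | smul c p _ hp => exact hp.const_smul c

theorem dense_symbolRel (a : Toeplitz n) {ε : ℝ} (hε : 0 < ε) :
    ∃ p ∈ symbolRel n, ‖p.1 - a‖ < ε := by
  have hle : StarAlgebra.adjoin ℂ {T : Hn n →L[ℂ] Hn n | ∃ i : Fin n, IsShift i T} ≤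
      ((symbolRel n).map (StarAlgHom.fst ℂ _ _)).map (Toeplitz n).subtype := by
    refine StarAlgebra.adjoin_le ?_
    rintro _ ⟨i, hi⟩
    obtain rfl := isShift_iff.1 hi
    refine ⟨⟨_, shift_mem_toeplitz _⟩, ⟨(⟨_, shift_mem_toeplitz (Pi.single i 1)⟩,
      mFourier fun j => ((Pi.single i 1 : Fin n → ℕ) j : ℤ)), ?_, rfl⟩, rfl⟩
    exact mem_symbolRel.2 (Submodule.subset_span
      ⟨_, isTranslation_shift _, isTranslation_star_shift _, rfl⟩)
  have ha : a.val ∈ closure (StarAlgebra.adjoin ℂ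
    {T : Hn n →L[ℂ] Hn n | ∃ i : Fin n, IsShift i T} : Set (Hn n →L[ℂ] Hn n)) := a.2
  obtain ⟨x, hx, hd⟩ := Metric.mem_closure_iff.1 ha ε hε
  obtain ⟨y, ⟨p, hp, rfl⟩, rfl⟩ := hle hx
  refine ⟨p, hp, ?_⟩
  rw [dist_comm, dist_eq_norm] at hd
  exact hd

/-- The symbol calculus of the Toeplitz algebra. -/
def toeplitzSymbol (n : ℕ) : SymbolSystem n (toeplitzCorner n) where
  rel := symbolRel n
  dense a _ hε := dense_symbolRel a hε
  contDiff _ hp := contDiff_of_mem_symbolRel hp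
  norm_le p hp := by
    obtain ⟨E, _, _, _, τ, -, horth, hτ⟩ := exists_hilbert_torus n
    have horth' : Orthonormal ℂ fun a : Fin n → ℕ => τ (monomialTorus a) :=
      horth.comp (fun a : Fin n → ℕ => fun i => (a i : ℤ)) fun a b h => by
        ext i
        exact Nat.cast_injective (congrFun h i)
    have hW := isometryOfOrthonormal_delta horth'
    filter_upwards [(hasSymbol_of_mem_symbolRel hW hp).norm_mul_shift_le hW hτ] with N hN
    have h1 : ‖p.1.val * shift (constIndex n N) * star (shift (constIndex n N))‖ ≤ ‖p.2‖ * 1 :=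
      (norm_mul_le _ _).trans (mul_le_mul hN (norm_star_shift_le _) (norm_nonneg _)
        (norm_nonneg _))
    rw [mul_one, mul_assoc] at h1
    exact h1
  exists_ne_zero {ι} _ r p hp h θ := by
    obtain ⟨E, _, _, _, τ, hinj, horth, hτ⟩ := exists_hilbert_torus n
    have horth' : Orthonormal ℂ fun a : Fin n → ℕ => τ (monomialTorus a) :=
      horth.comp (fun a : Fin n → ℕ => fun i => (a i : ℤ)) fun a b h => by
        ext i
        exact Nat.cast_injective (congrFun h i)
    have hW := isometryOfOrthonormal_delta horth'
    refine HasSymbol.exists_ne_zero hW hinj hτ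
      (fun i => hasSymbol_of_mem_symbolRel hW (hp i)) (r := fun i => (r i).val) ?_ θ
    have := congrArg (Toeplitz n).subtype h
    simpa using this

end SymbolSystem

section Loops

open Matrix Filter Topology

theorem eventually_forall_le_of_compact {K : Type*} [TopologicalSpace K] [CompactSpace K]
    {G : ℕ → K → ℝ} {c ε : ℝ} (hε : 0 < ε)
    (hG : ∀ t₀, ∀ δ > 0, ∀ᶠ t in 𝓝 t₀, ∀ N, G N t ≤ G N t₀ + δ)
    (h : ∀ t, ∀ δ > 0, ∀ᶠ N in atTop, G N t ≤ c + δ) : ∀ᶠ N in atTop, ∀ t, G N t ≤ c + ε := by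
  have := isCompact_univ (X := K) |>.induction_on
    (p := fun s => ∀ᶠ N in atTop, ∀ t ∈ s, G N t ≤ c + ε) (by simp)
    (fun s t hst ht => ht.mono fun N hN x hx => hN x (hst hx))
    (fun s t hs ht => by
      filter_upwards [hs, ht] with N h1 h2 x hx
      exact hx.elim (h1 x) (h2 x))
    (fun t₀ _ => by
      refine ⟨{t | ∀ N, G N t ≤ G N t₀ + ε / 2},
        mem_nhdsWithin_of_mem_nhds (hG t₀ _ (half_pos hε)), ?_⟩
      filter_upwards [h t₀ _ (half_pos hε)] with N hN t ht
      linarith [ht N])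
  simpa using this

theorem ContinuousMap.eventually_norm_mul_mul_le {K A : Type*} [TopologicalSpace K] [CompactSpace K]
    [NormedRing A] (γ : C(K, A)) {x y : ℕ → A} {C C' : ℝ} (hx : ∀ N, ‖x N‖ ≤ C)
    (hy : ∀ N, ‖y N‖ ≤ C') {c ε : ℝ} (hε : 0 < ε)
    (h : ∀ t, ∀ δ > 0, ∀ᶠ N in atTop, ‖x N * γ t * y N‖ ≤ c + δ) :
    ∀ᶠ N in atTop, ∀ t, ‖x N * γ t * y N‖ ≤ c + ε := by
  refine eventually_forall_le_of_compact hε (fun t₀ δ hδ => ?_) h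
  have hC : 0 ≤ C := (norm_nonneg _).trans (hx 0)
  have hC' : 0 ≤ C' := (norm_nonneg _).trans (hy 0)
  have hlim : Tendsto (fun t => C * ‖γ t - γ t₀‖ * C') (𝓝 t₀) (𝓝 0) := by
    have : Continuous fun t => C * ‖γ t - γ t₀‖ * C' := by fun_prop
    simpa using this.tendsto t₀
  filter_upwards [hlim.eventually_le_const hδ] with t ht N
  have heq : x N * γ t * y N = x N * γ t₀ * y N + x N * (γ t - γ t₀) * y N := by noncomm_ring
  rw [heq]
  refine (norm_add_le _ _).trans (add_le_add le_rfl (le_trans ?_ ht))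
  refine (norm_mul_le _ _).trans (mul_le_mul ((norm_mul_le _ _).trans ?_) (hy N) (norm_nonneg _)
    (by positivity))
  exact mul_le_mul_of_nonneg_right (hx N) (norm_nonneg _)

variable (A : Type*) [NormedRing A] [StarRing A] [NormedAlgebra ℂ A] [StarModule ℂ A]
  [ContinuousStar A]

/-- The algebra of loops in `A`. -/
def loopAlgebra : StarSubalgebra ℂ C(unitInterval, A) where
  carrier := {γ | γ 0 = γ 1}
  mul_mem' {a b} ha hb := by
    change a 0 * b 0 = a 1 * b 1
    rw [ha, hb]
  add_mem' {a b} ha hb := by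
    change a 0 + b 0 = a 1 + b 1
    rw [ha, hb]
  algebraMap_mem' c := rfl
  star_mem' {a} ha := congrArg star ha

instance [CompleteSpace A] : CompleteSpace (loopAlgebra A) := by
  have : IsClosed (loopAlgebra A : Set C(unitInterval, A)) :=
    isClosed_eq (ContinuousEvalConst.continuous_eval_const 0)
      (ContinuousEvalConst.continuous_eval_const 1)
  exact this.completeSpace_coe

variable {A}

theorem loop_norm_le {γ : loopAlgebra A} {c : ℝ} (hc : 0 ≤ c) (h : ∀ t, ‖γ.val t‖ ≤ c) :
    ‖γ‖ ≤ c :=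
  (ContinuousMap.norm_le _ hc).2 h

/-- The constant loop. -/
def constLoop (a : A) : loopAlgebra A := ⟨ContinuousMap.const _ a, rfl⟩

/-- The corner system of constant loops. -/
def CornerSystem.loop (X : CornerSystem A) : CornerSystem (loopAlgebra A) where
  s N := constLoop (X.s N)
  t N := constLoop (X.t N)
  t_mul_s N := Subtype.ext (ContinuousMap.ext fun _ => X.t_mul_s N)
  norm_le N := loop_norm_le zero_le_one fun _ => X.norm_le N
  mul_of_le h := Subtype.ext (ContinuousMap.ext fun _ => X.mul_of_le h)
  mul_of_le' h := Subtype.ext (ContinuousMap.ext fun _ => X.mul_of_le' h)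
  tendsto b N := by
    rw [Metric.tendsto_nhds]
    intro ε hε
    have := b.val.eventually_norm_mul_mul_le (x := X.p) (y := fun _ => 1 - X.p N) X.norm_le
      (fun _ => le_rfl) (c := 0) (half_pos hε) fun t δ hδ => by
        have := (X.tendsto (b.val t) N).norm
        rw [norm_zero] at this
        rw [zero_add]
        exact this.eventually_le_const hδ
    filter_upwards [this] with M hM
    rw [zero_add] at hM
    exact (dist_zero_right _).trans_lt <|
      (loop_norm_le (half_pos hε).le hM).trans_lt (half_lt_self hε)

theorem SymbolSystem.eventually_norm_mul_le {n : ℕ} {X : CornerSystem A} (S : SymbolSystem n X)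
    {γ : loopAlgebra A} {F : unitInterval → C(UnitAddTorus (Fin n), ℂ)}
    (h : ∀ t, (γ.val t, F t) ∈ S.rel) {c c' : ℝ} (hc : ∀ t, ‖F t‖ ≤ c) (hcc : c < c') :
    ∀ᶠ N in atTop, ‖γ * X.loop.p N‖ ≤ c' := by
  have := γ.val.eventually_norm_mul_mul_le (x := fun _ => 1) (y := X.p) (fun _ => le_rfl) X.norm_le
    (c := c) (sub_pos.2 hcc) fun t δ hδ => by
      filter_upwards [S.norm_le _ (h t)] with N hN
      rw [one_mul]
      exact hN.trans ((hc t).trans (by linarith))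
  filter_upwards [this] with N hN
  refine loop_norm_le (((norm_nonneg _).trans (hc 0)).trans hcc.le) fun t => ?_
  have := hN t
  rw [one_mul] at this
  exact this.trans (by linarith)

end Loops

section Columns

open Matrix Filter Topology

variable {ι : Type} [Fintype ι] [DecidableEq ι]

theorem ColumnEquiv.exists_dotProduct_eq_one {B : Type*} [Ring B] {v w r : ι → B}
    (h : ColumnEquiv v w) (hr : r ⬝ᵥ v = 1) : ∃ r', r' ⬝ᵥ w = 1 := by
  obtain ⟨g, rfl⟩ := h
  exact ⟨r ᵥ* g⁻¹.val, by rw [dotProduct_mulVec, vecMul_vecMul, g.inv_mul, vecMul_one, hr]⟩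

theorem columnEquiv_single_of_ne_zero {w : ι → ℂ} (hw : w ≠ 0) {i₁ i₂ : ι} (hi : i₂ ≠ i₁) :
    ColumnEquiv w (Pi.single i₁ 1) := by
  obtain ⟨k, hk, v, hv, hvk⟩ : ∃ k, k ≠ i₁ ∧ ∃ v, ColumnEquiv w v ∧ v k ≠ 0 := by
    by_cases h : ∃ k, k ≠ i₁ ∧ w k ≠ 0
    · obtain ⟨k, hk, h⟩ := h
      exact ⟨k, hk, w, ⟨1, by simp⟩, h⟩
    · push Not at h
      have h1 : w i₁ ≠ 0 := fun h1 => hw (funext fun j => by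
        rcases eq_or_ne j i₁ with rfl | hj
        · exact h1
        · exact h j hj)
      refine ⟨i₂, hi, _, columnEquiv_add_vecMulVec (a := Pi.single i₂ 1) (r := Pi.single i₁ 1)
        (by simp [hi.symm]), ?_⟩
      simp [h i₂ hi, h1]
  have step1 := columnEquiv_add_vecMulVec (a := Pi.single i₁ ((1 - v i₁) / v k))
    (r := Pi.single k 1) (v := v) (by simp [hk])
  set u : ι → ℂ := fun i => v i + (Pi.single i₁ ((1 - v i₁) / v k) : ι → ℂ) i *
    ((Pi.single k 1 : ι → ℂ) ⬝ᵥ v) with hu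
  have hu1 : u i₁ = 1 := by
    simp [hu, hvk]
  have step2 := columnEquiv_add_vecMulVec (a := Pi.single i₁ 1 - u) (r := Pi.single i₁ 1)
    (v := u) (by simp [hu1])
  refine hv.trans (step1.trans ?_)
  convert step2 using 1
  ext i
  simp [hu1]

theorem ColumnEquiv.map {B B' : Type*} [Ring B] [Ring B'] (f : B →+* B') {v w : ι → B}
    (h : ColumnEquiv v w) : ColumnEquiv (fun i => f (v i)) (fun i => f (w i)) := by
  obtain ⟨g, rfl⟩ := h
  refine ⟨Units.map f.mapMatrix.toMonoidHom g, ?_⟩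
  ext i
  simp [mulVec, dotProduct]

theorem eventually_exists_unit_eq_one_add {B : Type*} [NormedRing B] [CompleteSpace B]
    (v r : ι → B) : ∀ᶠ v' in 𝓝 v, ∃ g : (Matrix ι ι B)ˣ, g.val = 1 + vecMulVec (v' - v) r := by
  have hc : Continuous fun v' : ι → B => 1 + vecMulVec (v' - v) r := by
    refine continuous_const.add (continuous_matrix fun i j => ?_)
    simp only [vecMulVec_apply]
    fun_prop
  have hlim := hc.tendsto v
  simp only [sub_self, zero_vecMulVec, add_zero] at hlim
  exact hlim.eventually (eventually_isUnit_matrix isUnit_one)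

theorem eventually_columnEquiv {B : Type*} [NormedRing B] [CompleteSpace B]
    {v r : ι → B} (h : r ⬝ᵥ v = 1) : ∀ᶠ v' in 𝓝 v, ColumnEquiv v v' := by
  filter_upwards [eventually_exists_unit_eq_one_add v r] with v' ⟨g, hg⟩
  refine ⟨g, ?_⟩
  ext i
  rw [hg]
  simp [add_mulVec, vecMulVec_mulVec_apply, h]

/-- The orbit relation of invertible matrices on columns modulo a left ideal. -/
def ColumnEquivMod {B : Type*} [Ring B] (J : Ideal B) (v w : ι → B) : Prop :=
  ∃ g : (Matrix ι ι B)ˣ, ∀ i, (g.val *ᵥ v) i - w i ∈ J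

theorem mulVec_mem {B : Type*} [Ring B] {J : Ideal B} (g : Matrix ι ι B) {v : ι → B}
    (h : ∀ i, v i ∈ J) (i : ι) : (g *ᵥ v) i ∈ J :=
  J.sum_mem fun j _ => J.mul_mem_left _ (h j)

theorem ColumnEquivMod.trans {B : Type*} [Ring B] {J : Ideal B} {u v w : ι → B}
    (h : ColumnEquivMod J u v) (h' : ColumnEquivMod J v w) : ColumnEquivMod J u w := by
  obtain ⟨g, hg⟩ := h
  obtain ⟨g', hg'⟩ := h'
  refine ⟨g' * g, fun i => ?_⟩
  have := J.add_mem (mulVec_mem g'.val (v := g.val *ᵥ u - v) hg i) (hg' i)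
  rw [mulVec_sub, mulVec_mulVec, Pi.sub_apply] at this
  simpa using this

theorem ColumnEquivMod.symm {B : Type*} [Ring B] {J : Ideal B} {v w : ι → B}
    (h : ColumnEquivMod J v w) : ColumnEquivMod J w v := by
  obtain ⟨g, hg⟩ := h
  refine ⟨g⁻¹, fun i => ?_⟩
  have := J.neg_mem (mulVec_mem g⁻¹.val (v := g.val *ᵥ v - w) hg i)
  rw [mulVec_sub, mulVec_mulVec, g.inv_mul, one_mulVec, Pi.sub_apply, neg_sub] at this
  exact this

theorem ColumnEquiv.columnEquivMod {B : Type*} [Ring B] (J : Ideal B) {v w : ι → B}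
    (h : ColumnEquiv v w) : ColumnEquivMod J v w := by
  obtain ⟨g, rfl⟩ := h
  exact ⟨g, fun i => by simp⟩

theorem eventually_columnEquivMod {B : Type*} [NormedRing B] [CompleteSpace B] {J : Ideal B}
    {v r : ι → B} (h : r ⬝ᵥ v - 1 ∈ J) : ∀ᶠ v' in 𝓝 v, ColumnEquivMod J v v' := by
  filter_upwards [eventually_exists_unit_eq_one_add v r] with v' ⟨g, hg⟩
  refine ⟨g, fun i => ?_⟩
  have heq : (g.val *ᵥ v) i - v' i = (v' i - v i) * (r ⬝ᵥ v - 1) := by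
    rw [hg]
    simp [add_mulVec, vecMulVec_mulVec_apply, mul_sub]
    abel
  rw [heq]
  exact J.mul_mem_left _ h

theorem CornerSystem.columnEquiv_of_columnEquivMod {B : Type*} [NormedRing B] [CompleteSpace B]
    (X : CornerSystem B) {i₁ i₂ : ι} (hi : i₂ ≠ i₁) {r v : ι → B} (h : r ⬝ᵥ v = 1)
    (hv : ColumnEquivMod X.ideal v (Pi.single i₁ 1)) : ColumnEquiv v (Pi.single i₁ 1) := by
  obtain ⟨g, hg⟩ := hv
  have h1 : ColumnEquiv v (g.val *ᵥ v) := ⟨g, rfl⟩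
  obtain ⟨r', hr'⟩ := h1.exists_dotProduct_eq_one h
  exact h1.trans (X.columnEquiv_single hi hr' hg)

end Columns

section LeftInverse

open Matrix Filter Topology

variable {ι : Type} [Fintype ι] [DecidableEq ι]
variable {A : Type*} [NormedRing A] [StarRing A] [NormedAlgebra ℂ A] [StarModule ℂ A]
  [ContinuousStar A] [CompleteSpace A]

theorem Units.inv_mul_one_sub_sub_one {R : Type*} [Ring R] (e : Rˣ) {b p : R}
    (he : e.val = 1 - b * p) : e⁻¹.val * (1 - b) - 1 = -(e⁻¹.val * b) * (1 - p) := by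
  have h : e⁻¹.val * (1 - b * p) = 1 := by rw [← he, e.inv_mul]
  rw [← sub_eq_zero]
  refine Eq.trans ?_ (sub_eq_zero.2 h)
  noncomm_ring

theorem mul_one_sub_one_sub {R : Type*} [Ring R] (x y : R) : x * (1 - (1 - y)) = x * y := by
  rw [sub_sub_cancel]

theorem SymbolSystem.exists_leftInverse {n : ℕ} {X : CornerSystem A} (S : SymbolSystem n X)
    {v : ι → loopAlgebra A} {F : ι → C(unitInterval, C(UnitAddTorus (Fin n), ℂ))}
    (hrel : ∀ i t, ((v i).val t, F i t) ∈ S.rel) (hF : ∀ t θ, ∃ i, F i t θ ≠ 0) :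
    ∃ r : ι → loopAlgebra A, r ⬝ᵥ v - 1 ∈ X.loop.ideal := by
  let Y : unitInterval × UnitAddTorus (Fin n) → ℝ := fun p => ∑ i, ‖F i p.1 p.2‖ ^ 2
  have hYc : Continuous Y := by
    refine continuous_finsetSum _ fun i _ => Continuous.pow (Continuous.norm ?_) 2
    exact continuous_eval.comp ((F i).continuous.comp continuous_fst |>.prodMk continuous_snd)
  have hY0 : ∀ p, 0 < Y p := fun p => by
    obtain ⟨i, hi⟩ := hF p.1 p.2
    exact Finset.sum_pos' (fun _ _ => by positivity) ⟨i, Finset.mem_univ i, by positivity⟩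
  obtain ⟨p₀, -, hp₀⟩ := isCompact_univ.exists_isMinOn Set.univ_nonempty hYc.continuousOn
  obtain ⟨p₁, -, hp₁⟩ := isCompact_univ.exists_isMaxOn Set.univ_nonempty hYc.continuousOn
  set c := Y p₀
  set M := Y p₁
  have hc0 : 0 < c := hY0 p₀
  have hM0 : 0 < M := hY0 p₁
  have hc : ∀ p, c ≤ Y p := fun p => hp₀ (Set.mem_univ p)
  have hM : ∀ p, Y p ≤ M := fun p => hp₁ (Set.mem_univ p)
  let y : loopAlgebra A := ∑ i, star (v i) * v i
  let b : loopAlgebra A := 1 - ((M⁻¹ : ℝ) : ℂ) • y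
  let Fb : unitInterval → C(UnitAddTorus (Fin n), ℂ) := fun t =>
    1 - ((M⁻¹ : ℝ) : ℂ) • ∑ i, star (F i t) * F i t
  have hb : ∀ t, (b.val t, Fb t) ∈ S.rel := fun t => by
    have hsum : ∑ i, star ((v i).val t, F i t) * ((v i).val t, F i t) ∈ S.rel :=
      sum_mem fun i _ => mul_mem (star_mem (hrel i t)) (hrel i t)
    have hmem := sub_mem (one_mem S.rel) (SMulMemClass.smul_mem ((M⁻¹ : ℝ) : ℂ) hsum)
    convert hmem using 1
    ext1
    · simp [b, y, Prod.fst_sum]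
    · simp [Fb, Prod.snd_sum]
  have hFb : ∀ t, ‖Fb t‖ ≤ 1 - c / M := fun t => by
    have hcM : c / M ≤ 1 := (div_le_one hM0).2 (hc p₁)
    refine (ContinuousMap.norm_le _ (by linarith)).2 fun θ => ?_
    have heq : Fb t θ = ((1 - Y (t, θ) / M : ℝ) : ℂ) := by
      simp [Fb, Y, Complex.conj_mul', div_eq_inv_mul]
    rw [heq, Complex.norm_real, Real.norm_of_nonneg]
    · have := div_le_div_of_nonneg_right (hc (t, θ)) hM0.le
      linarith
    · have := (div_le_one hM0).2 (hM (t, θ))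
      linarith
  have hlt : 1 - c / M < 1 - c / M / 2 := by
    have : 0 < c / M := by positivity
    linarith
  obtain ⟨N, hN⟩ := (S.eventually_norm_mul_le hb hFb hlt).exists
  have hN1 : ‖b * X.loop.p N‖ < 1 := hN.trans_lt (by
    have : 0 < c / M := by positivity
    linarith)
  let e : (loopAlgebra A)ˣ := Units.oneSub (b * X.loop.p N) hN1
  have he : e.val = 1 - b * X.loop.p N := rfl
  refine ⟨fun i => e⁻¹.val * (((M⁻¹ : ℝ) : ℂ) • star (v i)), ?_⟩
  have h1 : (fun i => e⁻¹.val * (((M⁻¹ : ℝ) : ℂ) • star (v i))) ⬝ᵥ v = e⁻¹.val * (1 - b) := by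
    simp only [dotProduct, mul_assoc, smul_mul_assoc, ← Finset.mul_sum, ← Finset.smul_sum, b, y]
    exact (mul_one_sub_one_sub (R := loopAlgebra A) _ _).symm
  have h2 := Units.inv_mul_one_sub_sub_one e he
  rw [h1, h2]
  exact X.loop.ideal.mul_mem_left _ (X.loop.one_sub_p_mem N)

end LeftInverse

section Transitivity

open Matrix Filter Topology

variable {ι : Type} [Fintype ι] [DecidableEq ι]
variable {A : Type*} [NormedRing A] [StarRing A] [NormedAlgebra ℂ A] [StarModule ℂ A]
  [ContinuousStar A]

theorem norm_sum_smul_sub_le {E κ : Type*} [SeminormedAddCommGroup E] [NormedSpace ℂ E] [Fintype κ]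
    {b : κ → ℝ} (hb : ∀ k, 0 ≤ b k) (hb1 : ∑ k, b k = 1) {x y : κ → E} {ε : ℝ}
    (h : ∀ k, ‖x k - y k‖ ≤ ε) : ‖∑ k, (b k : ℂ) • x k - ∑ k, (b k : ℂ) • y k‖ ≤ ε := by
  rw [← Finset.sum_sub_distrib]
  refine (norm_sum_le _ _).trans ?_
  calc ∑ k, ‖(b k : ℂ) • x k - (b k : ℂ) • y k‖ ≤ ∑ k, b k * ε := by
        refine Finset.sum_le_sum fun k _ => ?_
        rw [← smul_sub, norm_smul, Complex.norm_real, Real.norm_of_nonneg (hb k)]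
        exact mul_le_mul_of_nonneg_left (h k) (hb k)
    _ = ε := by rw [← Finset.sum_mul, hb1, one_mul]

theorem SymbolSystem.exists_smooth_approx {n : ℕ} {X : CornerSystem A} (S : SymbolSystem n X)
    (γ : loopAlgebra A) {ε : ℝ} (hε : 0 < ε) :
    ∃ γ' : loopAlgebra A, dist γ' γ < ε ∧ ∃ F : C(unitInterval, C(UnitAddTorus (Fin n), ℂ)),
      (∀ t, (γ'.val t, F t) ∈ S.rel) ∧ ∃ Φ : ℝ × (Fin n → ℝ) → ℂ, ContDiff ℝ 1 Φ ∧
        ∀ (t : unitInterval) (θ : Fin n → ℝ), Φ (t, θ) = F t fun i => (θ i : UnitAddCircle) := by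
  choose P hP hPε using fun a => S.dense a (ε / 4) (by positivity)
  obtain ⟨N, hN, hN0⟩ := ((Metric.tendsto_nhds.1 (bernsteinApproximation_uniform γ.val) (ε / 4)
    (by positivity)).and (eventually_ne_atTop 0)).exists
  let z : Fin (N + 1) → unitInterval := bernstein.z
  let b : Fin (N + 1) → C(unitInterval, ℝ) := fun k => bernstein N k
  have hb0 : ∀ k, b k 0 = if k = 0 then 1 else 0 := fun k => by
    by_cases hk : k = 0
    · simp [b, bernstein_apply, hk]
    · have : (k : ℕ) ≠ 0 := fun h => hk (Fin.ext h)
      simp [b, bernstein_apply, hk, this]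
  have hb1 : ∀ k, b k 1 = if k = Fin.last N then 1 else 0 := fun k => by
    by_cases hk : k = Fin.last N
    · simp [b, bernstein_apply, hk]
    · have : (k : ℕ) < N := Fin.val_lt_last hk
      have : N - (k : ℕ) ≠ 0 := by omega
      simp [b, bernstein_apply, hk, this]
  let γ' : loopAlgebra A := ⟨⟨fun t => ∑ k, (b k t : ℂ) • (P (γ.val (z k))).1, by fun_prop⟩, by
    change ∑ k, (b k 0 : ℂ) • (P (γ.val (z k))).1 = ∑ k, (b k 1 : ℂ) • (P (γ.val (z k))).1
    simp only [hb0, hb1]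
    have : γ.val 0 = γ.val 1 := γ.2
    simp [z, bernstein.z_last hN0, this]⟩
  let F : C(unitInterval, C(UnitAddTorus (Fin n), ℂ)) :=
    ⟨fun t => ∑ k, (b k t : ℂ) • (P (γ.val (z k))).2, by fun_prop⟩
  refine ⟨γ', ?_, F, fun t => ?_, fun p => ∑ k : Fin (N + 1),
    ((N.choose k : ℂ) * (p.1 : ℂ) ^ (k : ℕ) * (1 - (p.1 : ℂ)) ^ (N - k)) *
      (P (γ.val (z k))).2 fun i => (p.2 i : UnitAddCircle), ?_, fun t θ => ?_⟩
  · have h : ‖γ' - γ‖ ≤ ε / 2 := loop_norm_le (by positivity) fun t => by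
      have h1 : ‖∑ k, (b k t : ℂ) • (P (γ.val (z k))).1 - ∑ k, (b k t : ℂ) • γ.val (z k)‖ ≤ ε / 4 :=
        norm_sum_smul_sub_le (fun k => bernstein_nonneg) (bernstein.probability N t)
          fun k => (hPε _).le
      have h2 : ‖∑ k, (b k t : ℂ) • γ.val (z k) - γ.val t‖ ≤ ε / 4 := by
        have := (ContinuousMap.norm_coe_le_norm _ t).trans (dist_eq_norm _ γ.val ▸ hN).le
        rw [ContinuousMap.sub_apply, bernsteinApproximation.apply] at this
        simpa only [Complex.coe_smul] using this
      have h3 := norm_add_le_of_le h1 h2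
      rw [sub_add_sub_cancel] at h3
      exact h3.trans (by linarith)
    exact (dist_eq_norm γ' γ).trans_lt (h.trans_lt (half_lt_self hε))
  · have : ∑ k, (b k t : ℂ) • P (γ.val (z k)) ∈ S.rel :=
      sum_mem fun k _ => SMulMemClass.smul_mem (b k t : ℂ) (hP (γ.val (z k)))
    convert this using 1
    ext1
    · simp [γ', Prod.fst_sum]
    · simp [F, Prod.snd_sum]
  · refine ContDiff.sum fun k _ => ContDiff.mul ?_ ?_
    · have h1 : ContDiff ℝ 1 fun p : ℝ × (Fin n → ℝ) => (p.1 : ℂ) :=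
        Complex.ofRealCLM.contDiff.comp contDiff_fst
      fun_prop
    · exact (S.contDiff _ (hP _)).comp contDiff_snd
  · simp [F, b, bernstein_apply]

theorem exists_ne_zero_forall_smul_ne {n : ℕ} (hn : n + 2 < 2 * Fintype.card ι)
    {Φ : ι → ℝ × (Fin n → ℝ) → ℂ} (hΦ : ∀ i, ContDiff ℝ 1 (Φ i)) :
    ∃ w : ι → ℂ, w ≠ 0 ∧ ∀ (c : ℝ) (t : ℝ) (θ : Fin n → ℝ), ∃ i, (c : ℂ) * Φ i (t, θ) ≠ w i := by
  let f : ℝ × (ℝ × (Fin n → ℝ)) → ι → ℂ := fun p i => (p.1 : ℂ) * Φ i p.2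
  have hf : ContDiff ℝ 1 f := contDiff_pi.2 fun i =>
    (Complex.ofRealCLM.contDiff.comp contDiff_fst).mul ((hΦ i).comp contDiff_snd)
  have hdim : Module.finrank ℝ (ℝ × (ℝ × (Fin n → ℝ))) < Module.finrank ℝ (ι → ℂ) := by
    rw [Module.finrank_pi_fintype]
    simp
    omega
  obtain ⟨w, hw⟩ := (hf.dense_compl_range_of_finrank_lt_finrank hdim).nonempty
  refine ⟨w, fun h => hw ⟨0, ?_⟩, fun c t θ => ?_⟩
  · ext i
    simp [f, h]
  · by_contra! hc
    exact hw ⟨(c, t, θ), funext hc⟩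

theorem columnEquivMod_of_path {B : Type*} [NormedRing B] [CompleteSpace B] {J : Ideal B}
    {V : unitInterval → ι → B} (hV : Continuous V) (h : ∀ s, ∃ r, r ⬝ᵥ V s - 1 ∈ J) :
    ColumnEquivMod J (V 0) (V 1) :=
  PreconnectedSpace.induction₂' (fun s s' => ColumnEquivMod J (V s) (V s'))
    (fun s => by
      obtain ⟨r, hr⟩ := h s
      filter_upwards [hV.continuousAt.eventually (eventually_columnEquivMod hr)] with s' hs'
      exact ⟨hs', hs'.symm⟩) ⟨fun _ _ _ h h' => h.trans h'⟩ 0 1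

theorem exists_pos_columnEquiv {B : Type*} [NormedRing B] [CompleteSpace B] {v r : ι → B}
    (h : r ⬝ᵥ v = 1) :
    ∃ ε > 0, ∀ v' : ι → B, (∀ i, dist (v' i) (v i) < ε) → ColumnEquiv v v' := by
  obtain ⟨ε, hε, hball⟩ := Metric.eventually_nhds_iff.1 (eventually_columnEquiv h)
  exact ⟨ε, hε, fun v' hv' => hball ((dist_pi_lt_iff hε).2 hv')⟩

set_option maxHeartbeats 800000 in
/-- Over the loop algebra, left invertible columns of large height are completable. -/
theorem SymbolSystem.columnEquiv_single [CompleteSpace A] {n : ℕ} {X : CornerSystem A}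
    (S : SymbolSystem n X) (hn : n + 2 < 2 * Fintype.card ι) {i₁ i₂ : ι} (hi : i₂ ≠ i₁)
    {v r : ι → loopAlgebra A} (h : r ⬝ᵥ v = 1) : ColumnEquiv v (Pi.single i₁ 1) := by
  obtain ⟨ε, hε, hball⟩ := exists_pos_columnEquiv (B := loopAlgebra A) h
  choose v' hv' F hrel Φ hΦ hΦF using fun i => S.exists_smooth_approx (v i) hε
  have hvv' : ColumnEquiv v v' := hball v' hv'
  obtain ⟨r', hr'⟩ := ColumnEquiv.exists_dotProduct_eq_one (B := loopAlgebra A) hvv' h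
  have hF : ∀ t θ, ∃ i, F i t θ ≠ 0 := fun t θ =>
    S.exists_ne_zero (fun i => (r' i).val t) (fun i => ((v' i).val t, F i t)) (fun i => hrel i t)
      (by simpa [dotProduct] using congrArg (fun γ : loopAlgebra A => γ.val t) hr') θ
  obtain ⟨w, hw, hwΦ⟩ := exists_ne_zero_forall_smul_ne hn hΦ
  let V : unitInterval → ι → loopAlgebra A := fun s i =>
    ((1 - s.val : ℝ) : ℂ) • v' i + (s.val : ℂ) • algebraMap ℂ (loopAlgebra A) (w i)
  let G : unitInterval → ι → C(unitInterval, C(UnitAddTorus (Fin n), ℂ)) := fun s i =>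
    ((1 - s.val : ℝ) : ℂ) • F i +
      (s.val : ℂ) • ContinuousMap.const _ (algebraMap ℂ C(UnitAddTorus (Fin n), ℂ) (w i))
  have hVG : ∀ s i t, ((V s i).val t, G s i t) ∈ S.rel := fun s i t =>
    add_mem (SMulMemClass.smul_mem _ (hrel i t))
      (SMulMemClass.smul_mem _ (algebraMap_mem S.rel (w i)))
  have hG : ∀ s t θ, ∃ i, G s i t θ ≠ 0 := fun s t θ => by
    by_contra! hc
    obtain ⟨θ', rfl⟩ : ∃ θ' : Fin n → ℝ, (fun i => (θ' i : UnitAddCircle)) = θ := by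
      choose θ' hθ' using fun i => QuotientAddGroup.mk_surjective (θ i)
      exact ⟨θ', funext hθ'⟩
    have hc' : ∀ i, ((1 - s.val : ℝ) : ℂ) * Φ i (t, θ') + (s.val : ℂ) * w i = 0 := fun i => by
      rw [hΦF]
      simpa [G] using hc i
    rcases eq_or_ne s.val 0 with hs | hs
    · obtain ⟨i, hi⟩ := hF t fun i => (θ' i : UnitAddCircle)
      have := hc' i
      rw [hs, hΦF] at this
      exact hi (by simpa using this)
    · obtain ⟨i, hi⟩ := hwΦ (-(1 - s.val) / s.val) t θ'
      have hs' : (s.val : ℂ) ≠ 0 := Complex.ofReal_ne_zero.2 hs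
      apply hi
      have := hc' i
      push_cast at this ⊢
      field_simp
      linear_combination -this
  have hVc : Continuous V := by fun_prop
  have key := columnEquivMod_of_path (B := loopAlgebra A) (J := X.loop.ideal) hVc
    fun s => S.exists_leftInverse (hVG s) (hG s)
  have hV0 : V 0 = v' := by
    ext1 i
    simp [V]
  have hV1 : V 1 = fun i => algebraMap ℂ (loopAlgebra A) (w i) := by
    ext1 i
    simp [V]
  have hw1 := (columnEquiv_single_of_ne_zero hw hi).map (B' := loopAlgebra A)
    (algebraMap ℂ (loopAlgebra A))
  have hsingle : (fun i => algebraMap ℂ (loopAlgebra A) ((Pi.single i₁ 1 : ι → ℂ) i)) =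
      Pi.single i₁ 1 := by
    ext1 i
    rcases eq_or_ne i i₁ with rfl | hne
    · simp
    · simp [hne]
  rw [hV0, hV1] at key
  rw [hsingle] at hw1
  exact hvv'.trans (X.loop.columnEquiv_of_columnEquivMod hi hr'
    (key.trans (hw1.columnEquivMod _)))

end Transitivity

section Destabilization

open Matrix Filter Topology

variable {ι : Type} [Fintype ι] [DecidableEq ι] {A : Type*}

/-- The invertible matrices whose last column is the last basis vector. -/
def lastColumnFixer (ι : Type) [Fintype ι] [DecidableEq ι] (A : Type*) [Ring A] :
    Subgroup (Matrix (ι ⊕ Unit) (ι ⊕ Unit) A)ˣ where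
  carrier := {W | W.val *ᵥ Pi.single (Sum.inr ()) 1 = Pi.single (Sum.inr ()) 1}
  one_mem' := one_mulVec _
  mul_mem' {W W'} h h' := by
    change (W.val * W'.val) *ᵥ _ = _
    rw [← mulVec_mulVec, h', h]
  inv_mem' {W} h := by
    change W⁻¹.val *ᵥ _ = _
    rw [← congrArg (W⁻¹.val *ᵥ ·) h, mulVec_mulVec, W.inv_mul, one_mulVec]

theorem toBlocks₁₂_of_mem_lastColumnFixer [Ring A] {W : (Matrix (ι ⊕ Unit) (ι ⊕ Unit) A)ˣ}
    (h : W ∈ lastColumnFixer ι A) : W.val.toBlocks₁₂ = 0 := by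
  ext i j
  have : W.val *ᵥ Pi.single (Sum.inr ()) 1 = Pi.single (Sum.inr ()) 1 := h
  simpa [toBlocks₁₂] using congrFun this (Sum.inl i)

/-- The upper left block of an invertible matrix whose last column is the last basis vector. -/
def upperLeftBlock (ι : Type) [Fintype ι] [DecidableEq ι] (A : Type*) [Ring A] :
    lastColumnFixer ι A →* (Matrix ι ι A)ˣ :=
  MonoidHom.toHomUnits
    { toFun := fun W => W.val.val.toBlocks₁₁
      map_one' := by simp [← fromBlocks_one]
      map_mul' := fun W W' => by
        change (W.val.val * W'.val.val).toBlocks₁₁ = _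
        rw [← fromBlocks_toBlocks W.val.val, ← fromBlocks_toBlocks W'.val.val, fromBlocks_multiply,
          toBlocks₁₂_of_mem_lastColumnFixer W.2]
        simp }

theorem upperLeftBlock_val [Ring A] (W : lastColumnFixer ι A) :
    (upperLeftBlock ι A W).val = W.val.val.toBlocks₁₁ := rfl

theorem continuous_upperLeftBlock [Ring A] [TopologicalSpace A] [IsTopologicalRing A] :
    Continuous (upperLeftBlock ι A) := by
  have h : Continuous fun W : lastColumnFixer ι A => (upperLeftBlock ι A W).val :=
    continuous_matrix fun i j =>
      (Units.continuous_val.comp continuous_subtype_val).matrix_elem (Sum.inl i) (Sum.inl j)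
  rw [Units.continuous_iff]
  refine ⟨h, ?_⟩
  have : (fun W : lastColumnFixer ι A => (upperLeftBlock ι A W)⁻¹.val) =
      fun W => (upperLeftBlock ι A W⁻¹).val := by
    ext1 W
    rw [map_inv]
  rw [this]
  exact h.comp (Continuous.subtype_mk (continuous_inv.comp continuous_subtype_val) _)

theorem stabilize_mem_lastColumnFixer [Ring A] (u : (Matrix ι ι A)ˣ) :
    stabilize Unit u ∈ lastColumnFixer ι A := by
  change (stabilize Unit u).val *ᵥ _ = _
  ext i
  rcases i with i | i <;> simp

theorem upperLeftBlock_stabilize [Ring A] (u : (Matrix ι ι A)ˣ) :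
    upperLeftBlock ι A ⟨stabilize Unit u, stabilize_mem_lastColumnFixer u⟩ = u := by
  ext i j
  simp [upperLeftBlock_val]

theorem joined_of_path_mul_mem_lastColumnFixer [Ring A] [TopologicalSpace A] [IsTopologicalRing A]
    {u : (Matrix ι ι A)ˣ} (w : Path (stabilize Unit u) 1)
    {g : unitInterval → (Matrix (ι ⊕ Unit) (ι ⊕ Unit) A)ˣ} (hg : Continuous g) (hg01 : g 0 = g 1)
    (h : ∀ t, g t * w t ∈ lastColumnFixer ι A) : Joined u 1 := by
  have hg1 : g 1 ∈ lastColumnFixer ι A := by simpa using h 1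
  let W : unitInterval → lastColumnFixer ι A := fun t => ⟨g t * w t, h t⟩
  have hW : Continuous W := (hg.mul w.continuous).subtype_mk _
  have hJ : Joined (W 0) (W 1) := ⟨⟨⟨W, hW⟩, rfl, rfl⟩⟩
  have h0 : W 0 = ⟨g 1, hg1⟩ * ⟨stabilize Unit u, stabilize_mem_lastColumnFixer u⟩ :=
    Subtype.ext (by simp [W, hg01])
  have h1 : W 1 = ⟨g 1, hg1⟩ := Subtype.ext (by simp [W])
  have := (Joined.refl (upperLeftBlock ι A ⟨g 1, hg1⟩)⁻¹).mul
    (hJ.map continuous_upperLeftBlock)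
  rwa [h0, h1, map_mul, upperLeftBlock_stabilize, inv_mul_cancel_left, inv_mul_cancel] at this

theorem reindexUnits_sumCongr_stabilize [Ring A] {κ τ : Type} [Fintype κ] [DecidableEq κ]
    [Fintype τ] [DecidableEq τ] (e : κ ≃ τ) (u : (Matrix ι ι A)ˣ) :
    reindexUnits (Equiv.sumCongr (Equiv.refl ι) e) (stabilize κ u) = stabilize τ u := by
  ext i j
  rcases i with i | i <;> rcases j with j | j <;> simp [reindexUnits, Matrix.one_apply]

theorem reindexUnits_sumEmpty_stabilize [Ring A] (u : (Matrix ι ι A)ˣ) :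
    reindexUnits (Equiv.sumEmpty ι (Fin 0)) (stabilize (Fin 0) u) = u := by
  ext i j
  simp [reindexUnits]

theorem reindexUnits_sumAssoc_symm_stabilize [Ring A] {κ τ : Type} [Fintype κ] [DecidableEq κ]
    [Fintype τ] [DecidableEq τ] (u : (Matrix ι ι A)ˣ) :
    reindexUnits (Equiv.sumAssoc ι κ τ).symm (stabilize (κ ⊕ τ) u) =
      stabilize τ (stabilize κ u) := by
  ext i j
  rcases i with (i | i) | i <;> rcases j with (j | j) | j <;>
    simp [reindexUnits, Matrix.one_apply]

theorem Joined.reindexUnits [Ring A] [TopologicalSpace A] {κ : Type} [Fintype κ] [DecidableEq κ]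
    {u : (Matrix ι ι A)ˣ} (h : Joined u 1) (e : ι ≃ κ) : Joined (_root_.reindexUnits e u) 1 := by
  simpa using h.map (continuous_reindexUnits e)

variable [NormedRing A] [StarRing A] [NormedAlgebra ℂ A] [StarModule ℂ A] [ContinuousStar A]

/-- Evaluation of loops. -/
def loopEval (A : Type*) [NormedRing A] [StarRing A] [NormedAlgebra ℂ A] [StarModule ℂ A]
    [ContinuousStar A] (t : unitInterval) : loopAlgebra A →+* A where
  toFun γ := γ.val t
  map_one' := rfl
  map_mul' _ _ := rfl
  map_zero' := rfl
  map_add' _ _ := rfl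

theorem continuous_map_loopEval {κ : Type} [Fintype κ] [DecidableEq κ]
    (g : (Matrix κ κ (loopAlgebra A))ˣ) :
    Continuous fun t => Units.map (loopEval A t).mapMatrix.toMonoidHom g := by
  rw [Units.continuous_iff]
  exact ⟨continuous_matrix fun i j => (g.val i j).val.continuous,
    continuous_matrix fun i j => (g⁻¹.val i j).val.continuous⟩

theorem SymbolSystem.joined_of_joined_stabilize [CompleteSpace A] {n : ℕ} {X : CornerSystem A}
    (S : SymbolSystem n X) [Nonempty ι] (hn : n < 2 * Fintype.card ι) {u : (Matrix ι ι A)ˣ}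
    (h : Joined (stabilize Unit u) 1) : Joined u 1 := by
  obtain ⟨w⟩ := h
  let v : ι ⊕ Unit → loopAlgebra A := fun i =>
    ⟨⟨fun t => (w t).val i (Sum.inr ()),
      (Units.continuous_val.comp w.continuous).matrix_elem i (Sum.inr ())⟩, by
      change (w 0).val i (Sum.inr ()) = (w 1).val i (Sum.inr ())
      rcases i with i | i <;> simp⟩
  let r : ι ⊕ Unit → loopAlgebra A := fun i =>
    ⟨⟨fun t => (w t)⁻¹.val (Sum.inr ()) i,
      (Units.continuous_coe_inv.comp w.continuous).matrix_elem (Sum.inr ()) i⟩, by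
      change (w 0)⁻¹.val (Sum.inr ()) i = (w 1)⁻¹.val (Sum.inr ()) i
      rcases i with i | i <;> simp⟩
  have hrv : r ⬝ᵥ v = 1 := by
    refine Subtype.ext (ContinuousMap.ext fun t => ?_)
    refine Eq.trans ?_ ((congrFun (congrFun (w t).inv_mul (Sum.inr ())) (Sum.inr ())).trans
      (one_apply_eq _))
    simp [dotProduct, r, v, mul_apply]
  obtain ⟨i₀⟩ := ‹Nonempty ι›
  obtain ⟨g, hg⟩ := S.columnEquiv_single (i₁ := Sum.inr ()) (i₂ := Sum.inl i₀)
    (by simp; omega) (by simp) hrv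
  refine joined_of_path_mul_mem_lastColumnFixer w (continuous_map_loopEval g) ?_ fun t => ?_
  · ext i j
    exact (g.val i j).2
  · change (_ * (w t).val) *ᵥ _ = _
    rw [← mulVec_mulVec]
    ext i
    have := congrArg (loopEval A t) (congrFun hg i)
    simp [mulVec, dotProduct] at this ⊢
    refine this.trans ?_
    rcases i with i | i
    · simp
    · simp

theorem SymbolSystem.joined_of_joined_stabilize_fin [CompleteSpace A] {n : ℕ} {X : CornerSystem A}
    (S : SymbolSystem n X) (m : ℕ) : ∀ {ι : Type} [Fintype ι] [DecidableEq ι] [Nonempty ι]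
    (_ : n < 2 * Fintype.card ι) {u : (Matrix ι ι A)ˣ} (_ : Joined (stabilize (Fin m) u) 1),
    Joined u 1 := by
  induction m with
  | zero =>
    intro ι _ _ _ hn u h
    simpa [reindexUnits_sumEmpty_stabilize] using h.reindexUnits (Equiv.sumEmpty ι (Fin 0))
  | succ m ih =>
    intro ι _ _ _ hn u h
    let e : Fin (m + 1) ≃ Unit ⊕ Fin m := Fintype.equivOfCardEq (by simp; omega)
    have := (h.reindexUnits (Equiv.sumCongr (Equiv.refl ι) e)).reindexUnits
      (Equiv.sumAssoc ι Unit (Fin m)).symm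
    rw [reindexUnits_sumCongr_stabilize, reindexUnits_sumAssoc_symm_stabilize] at this
    exact S.joined_of_joined_stabilize hn (ih (by simp; omega) this)

theorem SymbolSystem.joined_one [CompleteSpace A] {n : ℕ} {X : CornerSystem A}
    (S : SymbolSystem n X) (hA : KOneTrivial A) [Nonempty ι] (hn : n < 2 * Fintype.card ι)
    (u : (Matrix ι ι A)ˣ) : Joined u 1 := by
  obtain ⟨κ, _, _, h⟩ := hA ι u
  have := h.reindexUnits (Equiv.sumCongr (Equiv.refl ι) (Fintype.equivFin κ))
  rw [reindexUnits_sumCongr_stabilize] at this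
  exact S.joined_of_joined_stabilize_fin _ hn this

end Destabilization

theorem stmt4 (n : ℕ) (hn : 1 < n) (k : ℕ) (hk : n / 2 + 3 ≤ k) :
    ConnectedSpace (Matrix (Fin k) (Fin k) ↥(Toeplitz n))ˣ := by
  have : Nonempty (Fin k) := ⟨⟨0, by omega⟩⟩
  have h := (toeplitzSymbol n).joined_one (ι := Fin k) kOneTrivial_toeplitz (by simp; omega)
  have : PathConnectedSpace (Matrix (Fin k) (Fin k) ↥(Toeplitz n))ˣ :=
    ⟨⟨1⟩, fun u v => (h u).trans (h v).symm⟩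
  infer_instance
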